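/- arXiv:0707.3663 — 5 statements merged into one kernel-verified Lean document; each statement's English description precedes it below -/
import Mathlib

section
/- The integral from 0 to π/2 of x·ln(2 cos x) dx equals -(7/16)·ζ(3). -/
open Real

open Filter Topology MeasureTheory

lemma eio_congr {f g : ℕ → ℝ} {a : ℝ} (h : HasSum g a) (e : ∀ n, f n = g n) : HasSum f a := by
  rw [funext e]
  exact h

lemma eio_coeff (n : ℕ) : ∫ x in (0:ℝ)..(π/2), x * Real.cos (2 * n * x)
    = if n = 0 then π^2/8 else ((-1)^n - 1) / (4 * (n:ℝ)^2) := by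
  split_ifs with h
  · subst h
    simp
    ring
  · have hn : (n:ℝ) ≠ 0 := by exact_mod_cast h
    have key : ∀ x ∈ Set.uIcc (0:ℝ) (π/2), HasDerivAt
        (fun x : ℝ => x * Real.sin (2 * n * x) / (2 * n) + Real.cos (2 * n * x) / (4 * (n:ℝ)^2))
        (x * Real.cos (2 * n * x)) x := by
      intro x _
      have h1 : HasDerivAt (fun x : ℝ => 2 * (n:ℝ) * x) (2 * n) x := by
        simpa using (hasDerivAt_id x).const_mul (2 * (n:ℝ))
      have h2 := (((hasDerivAt_id x).mul h1.sin).div_const (2 * (n:ℝ))).add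
        (h1.cos.div_const (4 * (n:ℝ)^2))
      refine HasDerivAt.congr_deriv h2 ?_
      simp only [id]
      field_simp
      ring
    rw [intervalIntegral.integral_eq_sub_of_hasDerivAt key
      ((by fun_prop : Continuous fun x : ℝ => x * Real.cos (2 * n * x)).intervalIntegrable _ _)]
    have e : 2 * (n:ℝ) * (π/2) = n * π := by ring
    simp only [e, Real.sin_nat_mul_pi, Real.cos_nat_mul_pi]
    simp
    ring

lemma eio_log (r x : ℝ) (h0 : 0 ≤ r) (h1 : r < 1) :
    HasSum (fun n : ℕ => (-1:ℝ)^(n+1) * (r^n * Real.cos (2 * n * x)) / n)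
      (Real.log ‖(1:ℂ) + r * Complex.exp ((2 * x : ℝ) * Complex.I)‖) := by
  have hz : ‖(r:ℂ) * Complex.exp ((2 * x : ℝ) * Complex.I)‖ < 1 := by
    rw [norm_mul, Complex.norm_exp_ofReal_mul_I, Complex.norm_real, Real.norm_of_nonneg h0]
    simpa
  have := Complex.hasSum_re (Complex.hasSum_taylorSeries_log hz)
  rw [Complex.log_re] at this
  convert this using 2 with n
  have : (-1:ℂ)^(n+1) * ((r:ℂ) * Complex.exp ((2 * x : ℝ) * Complex.I))^n / n
      = (((-1:ℝ)^(n+1) * r^n / n : ℝ) : ℂ) * Complex.exp ((2 * n * x : ℝ) * Complex.I) := by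
    rw [mul_pow, ← Complex.exp_nat_mul]
    push_cast
    rw [show (n:ℂ) * (2 * x * Complex.I) = 2 * n * x * Complex.I by ring]
    ring
  rw [this, Complex.re_ofReal_mul, Complex.exp_ofReal_mul_I_re]
  ring

lemma eio_normSq (r x : ℝ) :
    ‖(1:ℂ) + r * Complex.exp ((2 * x : ℝ) * Complex.I)‖^2
      = (1 + r)^2 * Real.cos x^2 + (1 - r)^2 * Real.sin x^2 := by
  rw [← Complex.normSq_eq_norm_sq, Complex.normSq_apply]
  simp only [Complex.add_re, Complex.add_im, Complex.re_ofReal_mul, Complex.im_ofReal_mul,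
    Complex.exp_ofReal_mul_I_re, Complex.exp_ofReal_mul_I_im, Complex.one_re, Complex.one_im,
    Real.cos_two_mul, Real.sin_two_mul]
  have := Real.sin_sq x
  ring_nf
  simp only [this]
  ring

lemma eio_int (r : ℝ) (h0 : 0 ≤ r) (h1 : r < 1) :
    HasSum (fun n : ℕ => r^n * ((1:ℝ) * ((-1)^n - 1) / (4 * (n:ℝ)^3)))
      (∫ x in (0:ℝ)..(π/2), x * Real.log ‖(1:ℂ) + r * Complex.exp ((2 * x : ℝ) * Complex.I)‖) := by
  have := intervalIntegral.hasSum_integral_of_dominated_convergence (μ := volume)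
    (a := 0) (b := π/2)
    (F := fun (n : ℕ) x => x * ((-1:ℝ)^(n+1) * (r^n * Real.cos (2 * n * x)) / n))
    (f := fun x => x * Real.log ‖(1:ℂ) + r * Complex.exp ((2 * x : ℝ) * Complex.I)‖)
    (fun n _ => (π/2) * r^n) ?_ ?_ ?_ ?_ ?_
  · refine eio_congr this fun n => ?_
    have e : ∀ x : ℝ, x * ((-1:ℝ)^(n+1) * (r^n * Real.cos (2 * n * x)) / n)
        = ((-1:ℝ)^(n+1) * r^n / n) * (x * Real.cos (2 * n * x)) := fun x => by ring
    simp only [e]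
    rw [intervalIntegral.integral_const_mul, eio_coeff]
    split_ifs with h
    · simp [h]
    · have hn : (n:ℝ) ≠ 0 := by exact_mod_cast h
      field_simp
      rcases Nat.even_or_odd n with h | h
      · simp [h.neg_one_pow]
      · rw [pow_succ, h.neg_one_pow]; norm_num
  · intro n
    exact (by fun_prop : Continuous fun x : ℝ =>
      x * ((-1:ℝ)^(n+1) * (r^n * Real.cos (2 * n * x)) / n)).aestronglyMeasurable
  · intro n
    refine ae_of_all _ fun x hx => ?_
    rw [Set.uIoc_of_le (by positivity)] at hx
    rw [norm_mul, Real.norm_of_nonneg hx.1.le]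
    refine mul_le_mul hx.2 ?_ (norm_nonneg _) (by positivity)
    rw [norm_div, norm_mul, norm_mul, norm_pow, norm_pow, Real.norm_of_nonneg h0]
    simp only [norm_neg, norm_one, one_pow, one_mul, Real.norm_natCast]
    have hc : ‖Real.cos (2 * n * x)‖ ≤ 1 := Real.abs_cos_le_one _
    have hr : 0 ≤ r^n := by positivity
    rcases Nat.eq_zero_or_pos n with h | h
    · simp [h]
    · have hn : (1:ℝ) ≤ n := by exact_mod_cast h
      rw [div_le_iff₀ (by linarith)]
      nlinarith [mul_le_mul_of_nonneg_left hc hr, mul_le_mul_of_nonneg_left hn hr]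
  · exact ae_of_all _ fun x _ => (summable_geometric_of_lt_one h0 h1).mul_left _
  · simp
  · exact ae_of_all _ fun x _ => (eio_log r x h0 h1).mul_left x

lemma eio_bound (r x : ℝ) (h0 : 0 ≤ r) (h1 : r ≤ 1) (hc : 0 < Real.cos x) :
    |Real.log ‖(1:ℂ) + r * Complex.exp ((2 * x : ℝ) * Complex.I)‖|
      ≤ Real.log 2 + |Real.log (Real.cos x)| := by
  have hN := eio_normSq r x
  set N := ‖(1:ℂ) + r * Complex.exp ((2 * x : ℝ) * Complex.I)‖
  have hN0 : 0 ≤ N := norm_nonneg _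
  have l : Real.cos x ≤ N := by
    refine (pow_le_pow_iff_left₀ hc.le hN0 two_ne_zero).mp ?_
    rw [hN]
    nlinarith [mul_nonneg h0 (sq_nonneg (Real.cos x)), sq_nonneg ((1-r) * Real.sin x),
      sq_nonneg (r * Real.cos x)]
  have u : N ≤ 2 := by
    refine (pow_le_pow_iff_left₀ hN0 zero_le_two two_ne_zero).mp ?_
    rw [hN]
    nlinarith [Real.sin_sq_add_cos_sq x, sq_nonneg (Real.cos x), sq_nonneg (Real.sin x),
      mul_nonneg (by nlinarith : 0 ≤ 4 - (1+r)^2) (sq_nonneg (Real.cos x)),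
      mul_nonneg (by nlinarith : 0 ≤ 4 - (1-r)^2) (sq_nonneg (Real.sin x))]
  have a1 := Real.log_le_log hc l
  have a2 := Real.log_le_log (hc.trans_le l) u
  have := Real.log_pos (by norm_num : (1:ℝ) < 2)
  rw [abs_le]
  constructor
  · linarith [neg_abs_le (Real.log (Real.cos x))]
  · linarith [abs_nonneg (Real.log (Real.cos x))]

lemma eio_tendsto : Tendsto (fun r : ℝ =>
      ∫ x in (0:ℝ)..(π/2), x * Real.log ‖(1:ℂ) + r * Complex.exp ((2 * x : ℝ) * Complex.I)‖)
    (𝓝[<] 1) (𝓝 (∫ x in (0:ℝ)..(π/2), x * Real.log (2 * Real.cos x))) := by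
  have hev : ∀ᶠ r : ℝ in 𝓝[<] 1, 0 ≤ r ∧ r < 1 := by
    filter_upwards [Ioo_mem_nhdsLT (by norm_num : (0:ℝ) < 1)] with r hr
    exact ⟨hr.1.le, hr.2⟩
  have hne : ∀ᵐ x : ℝ, x ≠ π/2 := by
    simp [ae_iff]
  have hcos : ∀ x : ℝ, x ≠ π/2 → x ∈ Set.uIoc 0 (π/2) → 0 < Real.cos x := by
    intro x hx h
    rw [Set.uIoc_of_le (by positivity)] at h
    exact Real.cos_pos_of_mem_Ioo ⟨by linarith [h.1, Real.pi_pos], lt_of_le_of_ne h.2 hx⟩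
  refine intervalIntegral.tendsto_integral_filter_of_dominated_convergence
    (fun x => (π/2) * (Real.log 2 + |Real.log (Real.cos x)|)) ?_ ?_ ?_ ?_
  · refine Eventually.of_forall fun r => Measurable.aestronglyMeasurable ?_
    fun_prop
  · filter_upwards [hev] with r hr
    filter_upwards [hne] with x hx h
    have hc := hcos x hx h
    rw [Set.uIoc_of_le (by positivity)] at h
    rw [norm_mul, Real.norm_of_nonneg h.1.le]
    exact mul_le_mul h.2 (eio_bound r x hr.1 hr.2.le hc) (norm_nonneg _) (by positivity)
  · refine IntervalIntegrable.const_mul ?_ _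
    refine intervalIntegrable_const.add ?_
    exact (intervalIntegrable_log_cos (a := 0) (b := π/2)).abs
  · filter_upwards [hne] with x hx h
    have hc := hcos x hx h
    have e : ‖(1:ℂ) + (1:ℝ) * Complex.exp ((2 * x : ℝ) * Complex.I)‖ = 2 * Real.cos x := by
      rw [← sq_eq_sq₀ (norm_nonneg _) (by positivity), eio_normSq]
      ring
    have hcont : ContinuousAt (fun r : ℝ =>
        x * Real.log ‖(1:ℂ) + r * Complex.exp ((2 * x : ℝ) * Complex.I)‖) 1 := by
      refine continuousAt_const.mul (ContinuousAt.log (by fun_prop) ?_)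
      rw [e]; positivity
    have := hcont.tendsto
    rw [e] at this
    exact this.mono_left nhdsWithin_le_nhds

lemma eio_sum : HasSum (fun n : ℕ => (1:ℝ) * ((-1)^n - 1) / (4 * (n:ℝ)^3))
    (-(7/16) * ∑' n : ℕ, (1:ℝ) / ((n:ℝ) + 1)^3) := by
  have hs : Summable (fun n : ℕ => (1:ℝ) / (n:ℝ)^3) :=
    Real.summable_one_div_nat_pow.mpr (by norm_num)
  have hS : ∑' n : ℕ, (1:ℝ) / ((n:ℝ) + 1)^3 = ∑' n : ℕ, (1:ℝ) / (n:ℝ)^3 := by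
    rw [hs.tsum_eq_zero_add]
    simp
  rw [hS]
  have hodd : Summable (fun k : ℕ => (1:ℝ) / ((2 * k + 1 : ℕ):ℝ)^3) :=
    hs.comp_injective (i := fun k : ℕ => 2 * k + 1) (fun a b h => by simpa using h)
  have heven : HasSum (fun k : ℕ => (1:ℝ) / ((2 * k : ℕ):ℝ)^3)
      ((1/8) * ∑' n : ℕ, (1:ℝ) / (n:ℝ)^3) := by
    refine eio_congr (hs.hasSum.mul_left (1/8)) fun k => ?_
    push_cast
    rw [mul_pow, one_div_mul_one_div]
    norm_num
  have hT := (HasSum.even_add_odd (f := fun n : ℕ => (1:ℝ) / (n:ℝ)^3) heven hodd.hasSum).tsum_eq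
  have g := HasSum.even_add_odd (f := fun n : ℕ => (1:ℝ) * ((-1)^n - 1) / (4 * (n:ℝ)^3))
    (m := 0) (m' := (-1/2) * ∑' k : ℕ, (1:ℝ) / ((2 * k + 1 : ℕ):ℝ)^3) ?_ ?_
  · convert g using 1
    linarith
  · refine eio_congr hasSum_zero fun k => ?_
    simp
  · refine eio_congr (hodd.hasSum.mul_left (-1/2)) fun k => ?_
    rw [Odd.neg_one_pow ⟨k, rfl⟩]
    field_simp
    norm_num

theorem euler_integral_one :
    ∫ x in (0:ℝ)..(π/2), x * Real.log (2 * Real.cos x)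
      = -(7/16) * ∑' n : ℕ, (1:ℝ) / ((n:ℝ) + 1)^3 := by
  refine tendsto_nhds_unique eio_tendsto ?_
  have hev : ∀ᶠ r : ℝ in 𝓝[<] 1, 0 ≤ r ∧ r < 1 := by
    filter_upwards [Ioo_mem_nhdsLT (by norm_num : (0:ℝ) < 1)] with r hr
    exact ⟨hr.1.le, hr.2⟩
  have abel := Real.tendsto_tsum_powerSeries_nhdsWithin_lt eio_sum.tendsto_sum_nat
  refine abel.congr' ?_
  filter_upwards [hev] with r hr
  rw [← (eio_int r hr.1 hr.2).tsum_eq]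
  exact tsum_congr fun n => mul_comm _ _
end

section
/- The integral from 0 to π/2 of x²·ln(2 cos x) dx equals -(π/4)·ζ(3). -/
open Real

open Filter Topology MeasureTheory in
lemma aux_hasSum {r : ℝ} (h0 : 0 ≤ r) (h1 : r < 1) (x : ℝ) :
    HasSum (fun n : ℕ => (-1:ℝ)^(n+1) * r^n / n * Real.cos (2 * n * x))
      (Real.log ((1 - r)^2 + 4 * r * Real.cos x ^ 2) / 2) := by
  have hz : ‖(r:ℂ) * Complex.exp ((2 * x : ℝ) * Complex.I)‖ < 1 := by
    rw [norm_mul, Complex.norm_exp_ofReal_mul_I, Complex.norm_real, Real.norm_of_nonneg h0]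
    simpa using h1
  have h := Complex.hasSum_re (Complex.hasSum_taylorSeries_log hz)
  convert h using 1
  · funext n
    rw [mul_pow, ← Complex.exp_nat_mul]
    have e : (n:ℂ) * ((2 * x : ℝ) * Complex.I) = ((2 * n * x : ℝ) : ℂ) * Complex.I := by
      push_cast; ring
    have e2 : (-1:ℂ)^(n+1) * ((r:ℂ)^n * Complex.exp ((n:ℂ) * ((2 * x : ℝ) * Complex.I))) / n
        = (((-1:ℝ)^(n+1) * r^n / n : ℝ) : ℂ) * Complex.exp (((2 * n * x : ℝ) : ℂ) * Complex.I) := by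
      rw [e]; push_cast; ring
    rw [e2, Complex.re_ofReal_mul, Complex.exp_ofReal_mul_I_re]
  · rw [Complex.log_re]
    have e3 : (1 - r)^2 + 4 * r * Real.cos x ^ 2
        = ‖1 + (r:ℂ) * Complex.exp ((2 * x : ℝ) * Complex.I)‖ ^ 2 := by
      rw [Complex.sq_norm, Complex.normSq_apply]
      simp only [Complex.add_re, Complex.add_im, Complex.one_re, Complex.one_im,
        Complex.re_ofReal_mul, Complex.im_ofReal_mul, Complex.exp_ofReal_mul_I_re,
        Complex.exp_ofReal_mul_I_im]
      have := Real.sin_sq_add_cos_sq (2 * x)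
      have h2 := Real.cos_sq x
      rw [h2]
      linear_combination (-r^2) * this
    rw [e3, Real.log_pow]
    push_cast; ring

lemma aux_int (n : ℕ) : ∫ x in (0:ℝ)..(π/2), x^2 * Real.cos (2 * (n+1:ℕ) * x)
    = π * (-1)^(n+1) / (4 * ((n+1:ℕ):ℝ)^2) := by
  have hN : ((n+1:ℕ):ℝ) ≠ 0 := by positivity
  have hcos : Real.cos (2 * (n+1:ℕ) * (π/2)) = (-1)^(n+1) := by
    rw [← Real.cos_nat_mul_pi]; congr 1; ring
  have hsin : Real.sin (2 * (n+1:ℕ) * (π/2)) = 0 := by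
    rw [← Real.sin_nat_mul_pi (n+1)]; congr 1; ring
  generalize ((n+1:ℕ):ℝ) = N at *
  rw [intervalIntegral.integral_eq_sub_of_hasDerivAt
    (f := fun x => x^2 * Real.sin (2*N*x) / (2*N) + x * Real.cos (2*N*x) / (2*N^2)
      - Real.sin (2*N*x) / (4*N^3))]
  · simp only [hcos, hsin]
    simp
    field_simp
    ring
  · intro x _
    have hl : HasDerivAt (fun x : ℝ => 2*N*x) (2*N) x := by
      simpa using (hasDerivAt_id x).const_mul (2*N)
    have hs := hl.sin
    have hc := hl.cos
    convert! (((((hasDerivAt_id x).pow 2).mul hs).div_const (2*N)).add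
      (((hasDerivAt_id x).mul hc).div_const (2*N^2))).sub (hs.div_const (4*N^3)) using 1
    simp
    field_simp
    ring
  · apply Continuous.intervalIntegrable
    fun_prop

lemma aux_r {r : ℝ} (h0 : 0 ≤ r) (h1 : r < 1) :
    ∫ x in (0:ℝ)..(π/2), x^2 * (Real.log ((1 - r)^2 + 4 * r * Real.cos x ^ 2) / 2)
      = ∑' n : ℕ, -(π/4) * (r^n / (n:ℝ)^3) := by
  have H : HasSum (fun n : ℕ => ∫ x in (0:ℝ)..(π/2),
      x^2 * ((-1:ℝ)^(n+1) * r^n / n * Real.cos (2 * n * x)))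
      (∫ x in (0:ℝ)..(π/2), x^2 * (Real.log ((1 - r)^2 + 4 * r * Real.cos x ^ 2) / 2)) := by
    apply intervalIntegral.hasSum_integral_of_dominated_convergence
      (bound := fun n _ => (π/2)^2 * r^n)
    · intro n
      apply Continuous.aestronglyMeasurable
      fun_prop
    · intro n
      refine Filter.Eventually.of_forall fun x hx => ?_
      rw [Set.uIoc_of_le (by positivity)] at hx
      rw [norm_mul, norm_mul, norm_div, norm_mul, norm_pow, norm_pow, norm_pow]
      have a1 : ‖x‖^2 ≤ (π/2)^2 := by
        rw [Real.norm_of_nonneg hx.1.le]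
        exact pow_le_pow_left₀ hx.1.le hx.2 2
      have a2 : ‖Real.cos (2 * n * x)‖ ≤ 1 := Real.abs_cos_le_one _
      have a3 : ‖(-1:ℝ)‖^(n+1) * ‖r‖^n / ‖(n:ℝ)‖ ≤ r^n := by
        rw [Real.norm_of_nonneg h0]
        simp
        rcases Nat.eq_zero_or_pos n with h | h
        · subst h; simp
        · exact div_le_self (by positivity) (by exact_mod_cast h)
      apply mul_le_mul a1 _ (by positivity) (by positivity)
      calc _ ≤ r^n * 1 := mul_le_mul a3 a2 (by positivity) (by positivity)
        _ = r^n := mul_one _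
    · exact Filter.Eventually.of_forall fun x _ =>
        (summable_geometric_of_lt_one h0 h1).mul_left _
    · simp
    · exact Filter.Eventually.of_forall fun x _ => (aux_hasSum h0 h1 x).mul_left _
  rw [← H.tsum_eq]
  congr 1
  funext n
  rcases n with _ | n
  · simp
  · have : ∀ x : ℝ, x^2 * ((-1:ℝ)^(n+1+1) * r^(n+1) / (n+1:ℕ) * Real.cos (2 * (n+1:ℕ) * x))
      = ((-1:ℝ)^(n+1+1) * r^(n+1) / (n+1:ℕ)) * (x^2 * Real.cos (2 * (n+1:ℕ) * x)) := by
      intro x; ring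
    simp_rw [this]
    rw [intervalIntegral.integral_const_mul, aux_int]
    have hN : ((n+1:ℕ):ℝ) ≠ 0 := by positivity
    have hs : ((-1:ℝ)^(n+1))*((-1:ℝ)^(n+1)) = 1 := by
      rw [← mul_pow]; simp
    rw [pow_succ (-1:ℝ) (n+1)]
    generalize ((n+1:ℕ):ℝ) = N at *
    field_simp
    linear_combination (-r^(n+1)) * hs

open Filter Topology MeasureTheory in
theorem aux_lim :
    ∫ x in (0:ℝ)..(π/2), x^2 * Real.log (2 * Real.cos x)
      = ∑' n : ℕ, -(π/4) * (1 / (n:ℝ)^3) := by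
  have hev : ∀ᶠ r : ℝ in 𝓝[<] 1, 1/2 ≤ r ∧ r < 1 := by
    have : Set.Ioo (1/2:ℝ) 1 ∈ 𝓝[<] (1:ℝ) := Ioo_mem_nhdsLT (by norm_num)
    filter_upwards [this] with r hr using ⟨hr.1.le, hr.2⟩
  have hid : Tendsto (fun r : ℝ => r) (𝓝[<] 1) (𝓝 1) := tendsto_nhdsWithin_of_tendsto_nhds tendsto_id
  have hne : ∀ᵐ x : ℝ, x ≠ π/2 := by simp [ae_iff]
  have hpos : ∀ x : ℝ, x ≠ π/2 → x ∈ Set.uIoc 0 (π/2) → 0 < Real.cos x := by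
    intro x hx h
    rw [Set.uIoc_of_le (by positivity)] at h
    exact Real.cos_pos_of_mem_Ioo ⟨by linarith [h.1, Real.pi_pos], lt_of_le_of_ne h.2 hx⟩
  have L : Tendsto (fun r : ℝ => ∫ x in (0:ℝ)..(π/2),
      x^2 * (Real.log ((1 - r)^2 + 4 * r * Real.cos x ^ 2) / 2)) (𝓝[<] 1)
      (𝓝 (∫ x in (0:ℝ)..(π/2), x^2 * Real.log (2 * Real.cos x))) := by
    apply intervalIntegral.tendsto_integral_filter_of_dominated_convergence
      (bound := fun x => (π/2)^2 * (Real.log 4 + |Real.log (Real.cos x)|))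
    · refine Eventually.of_forall fun r => Measurable.aestronglyMeasurable ?_
      fun_prop
    · filter_upwards [hev] with r hr
      filter_upwards [hne] with x hx h
      have hc := hpos x hx h
      have hc1 := Real.cos_le_one x
      rw [Set.uIoc_of_le (by positivity)] at h
      rw [norm_mul, norm_pow, Real.norm_of_nonneg h.1.le]
      apply mul_le_mul (pow_le_pow_left₀ h.1.le h.2 2) _ (by positivity) (by positivity)
      have l1 : Real.cos x ^ 2 ≤ (1 - r)^2 + 4 * r * Real.cos x ^ 2 := by
        nlinarith [sq_nonneg (1-r), sq_nonneg (Real.cos x)]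
      have l2 : (1 - r)^2 + 4 * r * Real.cos x ^ 2 ≤ 4 := by
        have : Real.cos x ^ 2 ≤ 1 := by nlinarith
        nlinarith
      have l1' := Real.log_le_log (by positivity) l1
      have l2' := Real.log_le_log (lt_of_lt_of_le (by positivity) l1) l2
      rw [Real.log_pow] at l1'
      push_cast at l1'
      have h4 : 0 ≤ Real.log 4 := Real.log_nonneg (by norm_num)
      rw [Real.norm_eq_abs, abs_le]
      constructor
      · linarith [neg_abs_le (Real.log (Real.cos x))]
      · linarith [abs_nonneg (Real.log (Real.cos x))]
    · apply IntervalIntegrable.const_mul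
      apply IntervalIntegrable.add
      · simp
      · exact (intervalIntegrable_log_cos).abs
    · filter_upwards [hne] with x hx h
      have hc := hpos x hx h
      apply Tendsto.const_mul
      have e : Real.log (2 * Real.cos x)
          = Real.log ((1 - 1)^2 + 4 * 1 * Real.cos x ^ 2) / 2 := by
        have : ((1:ℝ) - 1)^2 + 4 * 1 * Real.cos x ^ 2 = (2 * Real.cos x)^2 := by ring
        rw [this, Real.log_pow]; push_cast; ring
      rw [e]
      refine Tendsto.div_const (Tendsto.log ?_ (by simp; positivity)) 2
      exact ((tendsto_const_nhds.sub hid).pow 2).add ((hid.const_mul 4).mul_const _)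
  have R : Tendsto (fun r : ℝ => ∑' n : ℕ, -(π/4) * (r^n / (n:ℝ)^3)) (𝓝[<] 1)
      (𝓝 (∑' n : ℕ, -(π/4) * (1 / (n:ℝ)^3))) := by
    apply tendsto_tsum_of_dominated_convergence (bound := fun n : ℕ => (π/4) * (1 / (n:ℝ)^3))
    · exact (Real.summable_one_div_nat_pow.mpr (by norm_num)).mul_left _
    · intro n
      have := (hid.pow n).div_const ((n:ℝ)^3) |>.const_mul (-(π/4))
      simpa using this
    · filter_upwards [hev] with r hr n
      have h0 : 0 ≤ r := by linarith
      have : 0 ≤ r^n / (n:ℝ)^3 := by positivity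
      rw [norm_mul, norm_neg, Real.norm_of_nonneg this, Real.norm_of_nonneg (by positivity)]
      gcongr
      exact pow_le_one₀ h0 hr.2.le
  refine tendsto_nhds_unique (L.congr' ?_) R
  filter_upwards [hev] with r hr
  exact aux_r (by linarith) hr.2

theorem euler_integral_two :
    ∫ x in (0:ℝ)..(π/2), x^2 * Real.log (2 * Real.cos x)
      = -(π/4) * ∑' n : ℕ, (1:ℝ) / ((n:ℝ) + 1)^3 := by
  rw [aux_lim, tsum_mul_left,
    (Real.summable_one_div_nat_pow.mpr (by norm_num : 1 < 3)).tsum_eq_zero_add]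
  simp
end

section
/- The integral from 0 to π/2 of x²·(ln(2 cos x))² dx equals 11π⁵/1440. -/
open Real


lemma z2s : HasSum (fun n : ℕ => (1:ℝ) / ((n:ℝ)+1)^2) (π^2/6) := by
  have := (hasSum_nat_add_iff' 1).2 hasSum_zeta_two
  simpa using this

lemma z4s : HasSum (fun n : ℕ => (1:ℝ) / ((n:ℝ)+1)^4) (π^4/90) := by
  have := (hasSum_nat_add_iff' 1).2 hasSum_zeta_four
  simpa using this

lemma sumsq : Summable (fun q : ℕ × ℕ => (1:ℝ) / ((q.1:ℝ)+1)^2 * (1 / ((q.2:ℝ)+1)^2)) := by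
  apply Summable.mul_of_nonneg z2s.summable z2s.summable <;> intro n <;> positivity

lemma sumT : Summable (fun q : ℕ × ℕ => (1:ℝ) / (((q.1:ℝ)+1) * ((q.2:ℝ)+1) * ((q.1:ℝ)+q.2+2)^2)) := by
  refine Summable.of_nonneg_of_le (fun q => by positivity) (fun q => ?_) sumsq
  rw [← one_div_mul_one_div_rev, ← one_div_mul_one_div_rev, one_div_mul_one_div, one_div_mul_one_div, one_div_mul_one_div]
  apply one_div_le_one_div_of_le (by positivity)
  have h1 : (0:ℝ) ≤ q.1 := by positivity
  have h2 : (0:ℝ) ≤ q.2 := by positivity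
  have : ((q.1:ℝ)+1) * ((q.2:ℝ)+1) ≤ ((q.1:ℝ)+q.2+2)^2 := by nlinarith [mul_nonneg h1 h2]
  have h3 : 0 ≤ ((q.1:ℝ)+1) * ((q.2:ℝ)+1) := by positivity
  nlinarith [mul_le_mul_of_nonneg_left this h3]

lemma sumZ : Summable (fun q : ℕ × ℕ => (1:ℝ) / (((q.1:ℝ)+1)^2 * ((q.1:ℝ)+q.2+2)^2)) := by
  refine Summable.of_nonneg_of_le (fun q => by positivity) (fun q => ?_) sumsq
  rw [one_div_mul_one_div]
  apply one_div_le_one_div_of_le (by positivity)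
  have h1 : (0:ℝ) ≤ q.1 := by positivity
  have h2 : (0:ℝ) ≤ q.2 := by positivity
  gcongr
  · linarith
  · norm_num

lemma sq_tsum : ∑' q : ℕ × ℕ, (1:ℝ) / ((q.1:ℝ)+1)^2 * (1 / ((q.2:ℝ)+1)^2) = (π^2/6)^2 := by
  rw [← Summable.tsum_mul_tsum z2s.summable z2s.summable sumsq, z2s.tsum_eq]; ring

lemma stuffle : ∑' q : ℕ × ℕ, (1:ℝ) / ((q.1:ℝ)+1)^2 * (1 / ((q.2:ℝ)+1)^2) =
    2 * ∑' q : ℕ × ℕ, (1:ℝ) / (((q.1:ℝ)+1)^2 * ((q.1:ℝ)+q.2+2)^2) + π^4/90 := by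
  set f : ℕ × ℕ → ℝ := fun q => (1:ℝ) / ((q.1:ℝ)+1)^2 * (1 / ((q.2:ℝ)+1)^2) with hf
  have hs : Summable f := sumsq
  have e : ∀ q, f q = Set.indicator {q | q.1 < q.2} f q + Set.indicator {q | q.2 < q.1} f q
      + Set.indicator {q | q.1 = q.2} f q := by
    intro q
    simp only [Set.indicator, Set.mem_ofPred_eq]
    rcases lt_trichotomy q.1 q.2 with h | h | h
    · simp [h, h.not_gt, h.ne]
    · simp [h]
    · simp [h, h.not_gt, h.ne']
  rw [tsum_congr e, Summable.tsum_add ((hs.indicator _).add (hs.indicator _)) (hs.indicator _),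
    Summable.tsum_add (hs.indicator _) (hs.indicator _)]
  have i1 : Function.Injective (fun q : ℕ × ℕ => (q.1, q.1 + q.2 + 1)) := by
    rintro ⟨a, b⟩ ⟨c, d⟩ h
    simp at h ⊢; omega
  have i2 : Function.Injective (fun q : ℕ × ℕ => (q.1 + q.2 + 1, q.1)) := by
    rintro ⟨a, b⟩ ⟨c, d⟩ h
    simp at h ⊢; omega
  have i3 : Function.Injective (fun n : ℕ => (n, n)) := by
    intro a b h
    simpa using h
  rw [← i1.tsum_eq (f := Set.indicator {q | q.1 < q.2} f), ← i2.tsum_eq (f := Set.indicator {q | q.2 < q.1} f),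
    ← i3.tsum_eq (f := Set.indicator {q | q.1 = q.2} f), two_mul, ← z4s.tsum_eq]
  · congr 1
    · congr 1
      · apply tsum_congr; intro q
        rw [Set.indicator_of_mem (by simp )]
        simp only [hf]; push_cast; rw [one_div_mul_one_div]; ring_nf
      · apply tsum_congr; intro q
        rw [Set.indicator_of_mem (by simp )]
        simp only [hf]; push_cast; rw [one_div_mul_one_div]; ring_nf
    · apply tsum_congr; intro q
      rw [Set.indicator_of_mem (by simp)]
      simp only [hf]; rw [one_div_mul_one_div]; ring_nf
  · rintro ⟨a, b⟩ h
    have := Set.mem_of_indicator_ne_zero h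
    exact ⟨a, by simpa using this⟩
  · rintro ⟨a, b⟩ h
    have h0 := Set.mem_of_indicator_ne_zero h
    have h : b < a := by simpa using h0
    exact ⟨(b, a - b - 1), by simp; omega⟩
  · rintro ⟨a, b⟩ h
    have h0 := Set.mem_of_indicator_ne_zero h
    have h : a < b := by simpa using h0
    exact ⟨(a, b - a - 1), by simp; omega⟩

lemma T_val : ∑' q : ℕ × ℕ, (1:ℝ) / (((q.1:ℝ)+1) * ((q.2:ℝ)+1) * ((q.1:ℝ)+q.2+2)^2) = π^4/180 := by
  have hsw : ∑' q : ℕ × ℕ, (1:ℝ) / (((q.2:ℝ)+1)^2 * ((q.2:ℝ)+q.1+2)^2) =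
      ∑' q : ℕ × ℕ, (1:ℝ) / (((q.1:ℝ)+1)^2 * ((q.1:ℝ)+q.2+2)^2) :=
    (Equiv.prodComm ℕ ℕ).tsum_eq (fun q : ℕ × ℕ => (1:ℝ) / (((q.1:ℝ)+1)^2 * ((q.1:ℝ)+q.2+2)^2))
  have hsum2 : Summable (fun q : ℕ × ℕ => (1:ℝ) / (((q.2:ℝ)+1)^2 * ((q.2:ℝ)+q.1+2)^2)) :=
    (Equiv.prodComm ℕ ℕ).summable_iff.2 sumZ
  have key : ∑' q : ℕ × ℕ, (1:ℝ) / ((q.1:ℝ)+1)^2 * (1 / ((q.2:ℝ)+1)^2) =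
      (∑' q : ℕ × ℕ, (1:ℝ) / (((q.1:ℝ)+1)^2 * ((q.1:ℝ)+q.2+2)^2) +
      ∑' q : ℕ × ℕ, (1:ℝ) / (((q.2:ℝ)+1)^2 * ((q.2:ℝ)+q.1+2)^2)) +
      2 * ∑' q : ℕ × ℕ, (1:ℝ) / (((q.1:ℝ)+1) * ((q.2:ℝ)+1) * ((q.1:ℝ)+q.2+2)^2) := by
    rw [← sumZ.tsum_add hsum2, ← tsum_mul_left, ← (sumZ.add hsum2).tsum_add (sumT.mul_left 2)]
    apply tsum_congr; intro q
    have h1 : (0:ℝ) ≤ q.1 := by positivity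
    have h2 : (0:ℝ) ≤ q.2 := by positivity
    have : (q.2:ℝ)+q.1+2 = q.1+q.2+2 := by ring
    rw [this]
    field_simp
    ring
  rw [hsw] at key
  have := stuffle
  linarith

lemma coef (p : ℕ) (hp : 0 < p) :
    ∫ x in (0:ℝ)..(π/2), x^2 * Real.cos (2 * p * x) = π * (-1)^p / (4 * p^2) := by
  have hp' : (p:ℝ) ≠ 0 := by positivity
  have hd : ∀ x ∈ Set.uIcc (0:ℝ) (π/2), HasDerivAt (fun x : ℝ => x^2 * Real.sin (2*p*x) / (2*p)
      + x * Real.cos (2*p*x) / (2*p^2) - Real.sin (2*p*x) / (4*p^3)) (x^2 * Real.cos (2 * p * x)) x := by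
    intro x _
    have h0 : HasDerivAt (fun x : ℝ => 2*p*x) (2*p) x := by
      simpa using (hasDerivAt_id x).const_mul (2*p : ℝ)
    have h1 := h0.sin
    have h2 := h0.cos
    have h3 := ((((hasDerivAt_pow 2 x).mul h1).div_const (2*p)).add
      (((hasDerivAt_id x).mul h2).div_const (2*p^2))).sub (h1.div_const (4*p^3))
    refine h3.congr_deriv ?_
    simp
    field_simp
    ring
  rw [intervalIntegral.integral_eq_sub_of_hasDerivAt hd
    (Continuous.intervalIntegrable (by fun_prop) _ _)]
  have e : 2 * (p:ℝ) * (π/2) = p * π := by ring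
  rw [e, Real.sin_nat_mul_pi, Real.cos_nat_mul_pi]
  simp
  field_simp
  ring

noncomputable def G (r x : ℝ) : ℂ := Complex.log (1 + r * Complex.exp (2 * x * Complex.I))

lemma norm_e (x : ℝ) : ‖Complex.exp (2 * x * Complex.I)‖ = 1 := by
  have := Complex.norm_exp_ofReal_mul_I (2*x)
  push_cast at this; exact this

lemma series (r x : ℝ) (h0 : 0 ≤ r) (h1 : r < 1) :
    HasSum (fun q : ℕ × ℕ => (-1)^(q.1+q.2+2) * r^(q.1+q.2+2) * Real.cos (2 * (q.1+q.2+2 : ℕ) * x)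
      / (((q.1:ℝ)+1) * ((q.2:ℝ)+1))) ((G r x)^2).re := by
  set z : ℂ := r * Complex.exp (2 * x * Complex.I) with hz
  have hn : ‖-z‖ < 1 := by
    rw [norm_neg, hz, norm_mul, norm_e]; simpa [abs_of_nonneg h0] using h1
  have hs := Complex.hasSum_taylorSeries_neg_log' hn
  have hsn : Summable (fun n : ℕ => ‖(-z)^(n+1) / ((n:ℂ)+1)‖) := by
    refine Summable.of_nonneg_of_le (fun n => norm_nonneg _) (fun n => ?_)
      (summable_geometric_of_lt_one (norm_nonneg _) hn)
    rw [norm_div, norm_pow]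
    have : (1:ℝ) ≤ ‖(n:ℂ)+1‖ := by
      have : ((n:ℂ)+1) = ((n+1:ℕ):ℂ) := by push_cast; rfl
      rw [this, Complex.norm_natCast]; simp
    refine (div_le_self (by positivity) this).trans ?_
    exact pow_le_pow_of_le_one (norm_nonneg _) hn.le (Nat.le_succ n)
  have hm := (summable_mul_of_summable_norm hsn hsn).hasSum
  rw [← tsum_mul_tsum_of_summable_norm hsn hsn, hs.tsum_eq] at hm
  have hre := Complex.hasSum_re hm
  have e1 : -Complex.log (1 - -z) * -Complex.log (1 - -z) = (G r x)^2 := by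
    rw [G, ← hz, sub_neg_eq_add]; ring
  rw [e1] at hre
  convert hre using 1
  funext q
  have e2 : (-z)^(q.1+1) / ((q.1:ℂ)+1) * ((-z)^(q.2+1) / ((q.2:ℂ)+1)) =
      (((-1)^(q.1+q.2+2) * r^(q.1+q.2+2) / (((q.1:ℝ)+1) * ((q.2:ℝ)+1)) : ℝ) : ℂ) *
      Complex.exp ((2 * (q.1+q.2+2 : ℕ) * x : ℝ) * Complex.I) := by
    have e3 : Complex.exp ((2 * (q.1+q.2+2 : ℕ) * x : ℝ) * Complex.I) =
        Complex.exp (2 * x * Complex.I)^(q.1+q.2+2) := by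
      rw [← Complex.exp_nat_mul]; congr 1; push_cast; ring
    rw [e3, hz, div_mul_div_comm, ← pow_add, neg_pow, mul_pow]
    push_cast
    ring
  rw [e2, Complex.re_ofReal_mul, Complex.exp_ofReal_mul_I_re]
  ring

lemma integ (r : ℝ) (h0 : 0 ≤ r) (h1 : r < 1) :
    HasSum (fun q : ℕ × ℕ => π / 4 * r^(q.1+q.2+2) * (1 / (((q.1:ℝ)+1) * ((q.2:ℝ)+1) * ((q.1:ℝ)+q.2+2)^2)))
     (∫ x in (0:ℝ)..(π/2), x^2 * ((G r x)^2).re) := by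
  have hg := summable_geometric_of_lt_one h0 h1
  have hb : Summable (fun q : ℕ × ℕ => r^q.1 * r^q.2) :=
    Summable.mul_of_nonneg hg hg (fun n => by positivity) (fun n => by positivity)
  have := intervalIntegral.hasSum_integral_of_dominated_convergence (μ := MeasureTheory.volume)
    (a := 0) (b := π/2)
    (F := fun (q : ℕ × ℕ) (x:ℝ) => x^2 * ((-1)^(q.1+q.2+2) * r^(q.1+q.2+2) * Real.cos (2 * (q.1+q.2+2 : ℕ) * x)
      / (((q.1:ℝ)+1) * ((q.2:ℝ)+1)))) (f := fun x => x^2 * ((G r x)^2).re)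
    (fun q x => x^2 * (r^q.1 * r^q.2))
    (fun q => Continuous.aestronglyMeasurable (by fun_prop)) ?_ ?_ ?_ ?_
  · convert! this using 1
    funext q
    have e : ∀ x : ℝ, x^2 * ((-1)^(q.1+q.2+2) * r^(q.1+q.2+2) * Real.cos (2 * (q.1+q.2+2 : ℕ) * x)
      / (((q.1:ℝ)+1) * ((q.2:ℝ)+1))) = ((-1)^(q.1+q.2+2) * r^(q.1+q.2+2) / (((q.1:ℝ)+1) * ((q.2:ℝ)+1)))
        * (x^2 * Real.cos (2 * (q.1+q.2+2 : ℕ) * x)) := by intro x; ring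
    simp_rw [e]
    rw [intervalIntegral.integral_const_mul, coef _ (by omega)]
    have : ((-1:ℝ)^(q.1+q.2+2))*((-1)^(q.1+q.2+2)) = 1 := by
      rw [← mul_pow]; simp
    push_cast
    calc _ = π / 4 * r^(q.1+q.2+2) * (1 / (((q.1:ℝ)+1) * ((q.2:ℝ)+1) * ((q.1:ℝ)+q.2+2)^2)) * (((-1:ℝ)^(q.1+q.2+2))*((-1)^(q.1+q.2+2))) := by rw [this, mul_one]
      _ = _ := by field_simp
  · intro q
    refine Filter.Eventually.of_forall (fun x _ => ?_)
    rw [norm_mul, norm_pow, norm_div, norm_mul, norm_mul]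
    simp only [norm_pow, norm_neg, norm_one, one_pow, one_mul, Real.norm_eq_abs, sq_abs, abs_of_nonneg h0]
    gcongr
    have a1 : (1:ℝ) ≤ |((q.1:ℝ)+1) * ((q.2:ℝ)+1)| := by
      rw [abs_of_nonneg (by positivity)]
      have h1 : (0:ℝ) ≤ q.1 := by positivity
      have h2 : (0:ℝ) ≤ q.2 := by positivity
      nlinarith [mul_nonneg h1 h2]
    refine (div_le_self (by positivity) a1).trans ?_
    rw [← pow_add]
    refine (mul_le_of_le_one_right (by positivity) (Real.abs_cos_le_one _)).trans ?_
    exact pow_le_pow_of_le_one h0 h1.le (by omega)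
  · exact Filter.Eventually.of_forall (fun x _ => hb.mul_left _)
  · simp_rw [tsum_mul_left]
    exact Continuous.intervalIntegrable (by fun_prop) _ _
  · exact Filter.Eventually.of_forall (fun x _ => (series r x h0 h1).mul_left _)

lemma normsq_w (r x : ℝ) : ‖(1 + r * Complex.exp (2 * x * Complex.I) : ℂ)‖^2 =
    (1 + r * Real.cos (2*x))^2 + (r * Real.sin (2*x))^2 := by
  have : (1 + r * Complex.exp (2 * x * Complex.I) : ℂ) =
    ((1 + r * Real.cos (2*x) : ℝ) : ℂ) + ((r * Real.sin (2*x) : ℝ) : ℂ) * Complex.I := by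
    rw [Complex.exp_mul_I]; push_cast; ring
  rw [this, ← Complex.normSq_eq_norm_sq, Complex.normSq_add_mul_I]

lemma G_bound (r x : ℝ) (h0 : 0 ≤ r) (h1 : r ≤ 1) (hx0 : 0 < x) (hx : x < π/2) :
    ‖G r x‖ ≤ 9 * ((π/2 - x)/2)^(-(1/4):ℝ) := by
  set t := (π/2 - x)/2 with ht
  have hpi := Real.pi_lt_four
  have hpi0 := Real.pi_pos
  have ht0 : 0 < t := by rw [ht]; linarith
  have ht1 : t ≤ 1 := by rw [ht]; linarith
  have hc : t ≤ Real.cos x := by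
    have h := Real.one_sub_mul_le_cos hx0.le hx.le
    have : t ≤ 1 - 2 / π * x := by
      have e : 1 - 2/π*x = (4/π) * t := by rw [ht]; field_simp; ring
      rw [e]
      have : 1 ≤ 4/π := by rw [one_le_div hpi0]; exact hpi.le
      nlinarith
    linarith
  set w : ℂ := 1 + r * Complex.exp (2 * x * Complex.I) with hw
  have hsq := normsq_w r x
  rw [← hw] at hsq
  have hsc := Real.sin_sq_add_cos_sq (2*x)
  have hcc := Real.cos_two_mul x
  have hc1 := Real.cos_le_one (2*x)
  have hc2 := Real.neg_one_le_cos (2*x)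
  have hexp : ‖w‖^2 = 1 + 2*r*Real.cos (2*x) + r^2 := by
    rw [hsq]; linear_combination r^2 * hsc
  have hlow : Real.cos x ≤ ‖w‖ := by
    apply abs_le_of_sq_le_sq' _ (norm_nonneg _) |>.2
    rw [hexp]
    have : Real.cos x^2 = (1 + Real.cos (2*x))/2 := by linarith
    rw [this]
    set c := Real.cos (2*x)
    rcases le_total 0 c with h | h
    · nlinarith [mul_nonneg h0 h, sq_nonneg r]
    · nlinarith [sq_nonneg (r + c), mul_nonneg (by linarith : 0 ≤ 1 + c) (by linarith : 0 ≤ 1/2 - c)]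
  have hup : ‖w‖ ≤ 2 := by
    apply abs_le_of_sq_le_sq' _ (by norm_num) |>.2
    rw [hexp]; nlinarith
  have hwt : t ≤ ‖w‖ := hc.trans hlow
  have hlt : -Real.log t ≤ 4 * t^(-(1/4):ℝ) := by
    have h := Real.abs_log_mul_self_rpow_lt t (1/4) ht0 ht1 (by norm_num)
    have h' := (abs_lt.1 h).1
    have hp : 0 < t^(1/4:ℝ) := Real.rpow_pos_of_pos ht0 _
    rw [Real.rpow_neg ht0.le, ← div_eq_mul_inv, le_div_iff₀ hp]
    norm_num at h' ⊢
    linarith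
  have hone : 1 ≤ t^(-(1/4):ℝ) := Real.one_le_rpow_of_pos_of_le_one_of_nonpos ht0 ht1 (by norm_num)
  have hlog2 : Real.log 2 < 1 := by have := Real.log_two_lt_d9; linarith
  have hll : Real.log t ≤ Real.log ‖w‖ := Real.log_le_log ht0 hwt
  have hlu : Real.log ‖w‖ ≤ Real.log 2 := Real.log_le_log (ht0.trans_le hwt) hup
  have hre : |(Complex.log w).re| ≤ 4 * t^(-(1/4):ℝ) + 1 := by
    rw [Complex.log_re, abs_le]; constructor <;> linarith
  have him : |(Complex.log w).im| ≤ 4 := by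
    rw [Complex.log_im]; exact (Complex.abs_arg_le_pi w).trans hpi.le
  have := Complex.norm_le_abs_re_add_abs_im (Complex.log w)
  rw [G, ← hw]
  linarith

lemma F_bound (r x : ℝ) (h0 : 0 ≤ r) (h1 : r ≤ 1) (hx0 : 0 < x) (hx : x < π/2) :
    ‖x^2 * ((G r x)^2).re‖ ≤ 324 * ((π/2 - x)/2)^(-(1/2):ℝ) := by
  have hb := G_bound r x h0 h1 hx0 hx
  have ht0 : 0 < (π/2 - x)/2 := by linarith
  have e : ((π/2 - x)/2)^(-(1/2):ℝ) = (((π/2 - x)/2)^(-(1/4):ℝ))^2 := by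
    rw [← Real.rpow_natCast, ← Real.rpow_mul ht0.le]; norm_num
  rw [e, norm_mul]
  have h2 : ‖((G r x)^2).re‖ ≤ (9 * ((π/2 - x)/2)^(-(1/4):ℝ))^2 := by
    refine (Complex.abs_re_le_norm _).trans ?_
    rw [norm_pow]; gcongr
  have hx4 : ‖x^2‖ ≤ 4 := by
    rw [Real.norm_eq_abs, abs_of_nonneg (by positivity)]
    nlinarith [Real.pi_lt_four]
  calc _ ≤ 4 * (9 * ((π/2 - x)/2)^(-(1/4):ℝ))^2 := by gcongr
    _ = _ := by ring

lemma bound_int : IntervalIntegrable (fun x : ℝ => 324 * ((π/2 - x)/2)^(-(1/2):ℝ)) MeasureTheory.volume 0 (π/2) := by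
  apply IntervalIntegrable.const_mul
  have h : IntervalIntegrable (fun x : ℝ => x^(-(1/2):ℝ)) MeasureTheory.volume 0 (π/4) :=
    intervalIntegral.intervalIntegrable_rpow' (by norm_num)
  have h2 := h.comp_mul_left (c := 1/2)
  have h3 := (h2.comp_sub_left (π/2)).symm
  convert h3 using 1
  · funext x; congr 1; ring
  · ring
  · ring

lemma G_one (x : ℝ) (hx0 : 0 < x) (hx : x < π/2) :
    x^2 * ((G 1 x)^2).re = x^2 * (Real.log (2 * Real.cos x))^2 - x^4 := by
  have hc : 0 < Real.cos x := Real.cos_pos_of_mem_Ioo ⟨by linarith, hx⟩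
  have e : (1 + (1:ℝ) * Complex.exp (2 * x * Complex.I) : ℂ) = ((2 * Real.cos x : ℝ) : ℂ) * Complex.exp (x * Complex.I) := by
    push_cast
    rw [Complex.two_cos, add_mul, ← Complex.exp_add, ← Complex.exp_add]
    rw [show (x:ℂ) * Complex.I + x * Complex.I = 2 * x * Complex.I by ring,
      show -(x:ℂ) * Complex.I + x * Complex.I = 0 by ring, Complex.exp_zero]
    ring
  rw [G, e, Complex.log_ofReal_mul (by positivity) (Complex.exp_ne_zero _), Complex.log_exp]
  · simp [pow_two]; ring
  · simp; linarith
  · simp; linarith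

lemma G_tendsto (x : ℝ) (hx0 : 0 < x) (hx : x < π/2) :
    Filter.Tendsto (fun r => x^2 * ((G r x)^2).re) (nhdsWithin 1 (Set.Iio 1)) (nhds (x^2 * ((G 1 x)^2).re)) := by
  apply Filter.Tendsto.mono_left _ nhdsWithin_le_nhds
  have : ContinuousAt (fun r : ℝ => G r x) 1 := by
    unfold G
    apply ContinuousAt.clog (by fun_prop)
    left
    have hc : 0 < Real.cos x := Real.cos_pos_of_mem_Ioo ⟨by linarith, hx⟩
    have e : (2 * x * Complex.I : ℂ) = ((2*x:ℝ):ℂ) * Complex.I := by push_cast; rfl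
    rw [e, Complex.add_re, Complex.re_ofReal_mul, Complex.exp_ofReal_mul_I_re, Real.cos_two_mul]
    simp; positivity
  have h2 : ContinuousAt (fun r : ℝ => x^2 * ((G r x)^2).re) 1 :=
    continuousAt_const.mul (Complex.continuous_re.continuousAt.comp (this.pow 2))
  exact h2

lemma G_meas (r : ℝ) : Measurable (fun x : ℝ => x^2 * ((G r x)^2).re) := by
  unfold G
  fun_prop

lemma ae_ioo {P : ℝ → Prop} (h : ∀ x, 0 < x → x < π/2 → P x) :
    ∀ᵐ x : ℝ, x ∈ Set.uIoc 0 (π/2) → P x := by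
  have : ∀ᵐ x : ℝ, x ≠ π/2 := by simp [MeasureTheory.ae_iff]
  filter_upwards [this] with x hx hm
  rw [Set.uIoc_of_le (by positivity)] at hm
  exact h x hm.1 (lt_of_le_of_ne hm.2 hx)

theorem au_yeung_integral :
    ∫ x in (0:ℝ)..(π/2), x^2 * (Real.log (2 * Real.cos x))^2
      = 11 * π^5 / 1440 := by
  have hev : ∀ᶠ r : ℝ in nhdsWithin 1 (Set.Iio 1), 0 ≤ r ∧ r < 1 := by
    have h1 : ∀ᶠ r : ℝ in nhdsWithin 1 (Set.Iio 1), 0 < r :=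
      nhdsWithin_le_nhds (lt_mem_nhds one_pos)
    filter_upwards [h1, self_mem_nhdsWithin] with r h h'
    exact ⟨h.le, h'⟩
  have lim1 : Filter.Tendsto (fun r => ∫ x in (0:ℝ)..(π/2), x^2 * ((G r x)^2).re)
      (nhdsWithin 1 (Set.Iio 1)) (nhds (∫ x in (0:ℝ)..(π/2), x^2 * ((G 1 x)^2).re)) := by
    refine intervalIntegral.tendsto_integral_filter_of_dominated_convergence _
      (Filter.Eventually.of_forall fun r => (G_meas r).aestronglyMeasurable) ?_ bound_int
      (ae_ioo fun x h0 h1 => G_tendsto x h0 h1)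
    filter_upwards [hev] with r hr
    exact ae_ioo fun x h0 h1 => F_bound r x hr.1 hr.2.le h0 h1
  have lim2 : Filter.Tendsto (fun r : ℝ => ∑' q : ℕ × ℕ, π / 4 * r^(q.1+q.2+2) *
      (1 / (((q.1:ℝ)+1) * ((q.2:ℝ)+1) * ((q.1:ℝ)+q.2+2)^2))) (nhdsWithin 1 (Set.Iio 1))
      (nhds (∑' q : ℕ × ℕ, π / 4 *
      (1 / (((q.1:ℝ)+1) * ((q.2:ℝ)+1) * ((q.1:ℝ)+q.2+2)^2)))) := by
    refine tendsto_tsum_of_dominated_convergence (sumT.mul_left (π/4)) ?_ ?_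
    · intro q
      apply Filter.Tendsto.mono_left _ nhdsWithin_le_nhds
      have : Continuous (fun r : ℝ => π / 4 * r^(q.1+q.2+2) *
        (1 / (((q.1:ℝ)+1) * ((q.2:ℝ)+1) * ((q.1:ℝ)+q.2+2)^2))) := by fun_prop
      simpa using this.tendsto 1
    · filter_upwards [hev] with r hr q
      have hr0 := hr.1
      rw [Real.norm_eq_abs, abs_of_nonneg (by positivity)]
      gcongr
      exact mul_le_of_le_one_right (by positivity) (pow_le_one₀ hr.1 hr.2.le)
  have heq : ∫ x in (0:ℝ)..(π/2), x^2 * ((G 1 x)^2).re = π/4 * (π^4/180) := by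
    rw [← T_val, ← tsum_mul_left]
    refine tendsto_nhds_unique lim1 (lim2.congr' ?_)
    filter_upwards [hev] with r hr
    exact (integ r hr.1 hr.2).tsum_eq
  have hgint : IntervalIntegrable (fun x : ℝ => x^2 * ((G 1 x)^2).re) MeasureTheory.volume 0 (π/2) := by
    refine bound_int.mono_fun' (G_meas 1).aestronglyMeasurable ?_
    exact (MeasureTheory.ae_restrict_iff' measurableSet_uIoc).2
      (ae_ioo fun x h0 h1 => F_bound 1 x zero_le_one le_rfl h0 h1)
  have hcong : ∫ x in (0:ℝ)..(π/2), x^2 * (Real.log (2 * Real.cos x))^2 =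
      ∫ x in (0:ℝ)..(π/2), (x^2 * ((G 1 x)^2).re + x^4) := by
    apply intervalIntegral.integral_congr_ae
    exact ae_ioo fun x h0 h1 => by rw [G_one x h0 h1]; ring
  rw [hcong, intervalIntegral.integral_add hgint (Continuous.intervalIntegrable (by fun_prop) _ _),
    heq, integral_pow]
  norm_num
  ring
end

section
/- For real t > 0 and every nonnegative integer j, ∑_{ν=1}^{∞} ((-1)^ν/ν)·C(t, ν+j) = C(t,j)·(ψ(j+1) - ψ(t+1)), where C(t,m) denotes the generalized binomial coefficient t(t-1)···(t-m+1)/m! and ψ is the digamma function. -/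
/-- The digamma function ψ(x) = d/dx ln Γ(x). -/
noncomputable def digamma (x : ℝ) : ℝ := deriv (fun y => Real.log (Real.Gamma y)) x

/-- Generalized binomial coefficient C(t, m) = t(t-1)⋯(t-m+1)/m!. -/
noncomputable def rchoose (t : ℝ) (m : ℕ) : ℝ :=
  (∏ i ∈ Finset.range m, (t - i)) / m.factorial

lemma rchoose_zero (t : ℝ) : rchoose t 0 = 1 := by simp [rchoose]

lemma rchoose_succ (t : ℝ) (m : ℕ) :
    ((m : ℝ) + 1) * rchoose t (m + 1) = (t - m) * rchoose t m := by
  have h : ((m.factorial : ℕ) : ℝ) ≠ 0 := by positivity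
  have h2 : ((m : ℝ) + 1) ≠ 0 := by positivity
  simp only [rchoose, Finset.prod_range_succ, Nat.factorial_succ]
  push_cast
  field_simp

lemma rchoose_absorb (t : ℝ) (m : ℕ) :
    ((m : ℝ) + 1) * rchoose (t + 1) (m + 1) = (t + 1) * rchoose t m := by
  have h : ((m.factorial : ℕ) : ℝ) ≠ 0 := by positivity
  have h2 : ((m : ℝ) + 1) ≠ 0 := by positivity
  simp only [rchoose, Finset.prod_range_succ', Nat.factorial_succ]
  push_cast
  have : ∏ k ∈ Finset.range m, (t + 1 - ((k : ℝ) + 1)) = ∏ k ∈ Finset.range m, (t - (k : ℝ)) :=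
    Finset.prod_congr rfl fun k _ => by ring
  rw [this]
  field_simp
  ring

lemma rchoose_pascal (t : ℝ) (m : ℕ) :
    rchoose (t + 1) (m + 1) = rchoose t (m + 1) + rchoose t m := by
  have h2 : ((m : ℝ) + 1) ≠ 0 := by positivity
  apply mul_left_cancel₀ h2
  rw [rchoose_absorb, mul_add, rchoose_succ]
  ring

lemma rchoose_eq_ring (t : ℝ) (m : ℕ) : Ring.choose t m = rchoose t m := by
  induction m with
  | zero => simp [rchoose_zero]
  | succ m ih =>
    have h2 : ((m : ℝ) + 1) ≠ 0 := by positivity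
    apply mul_left_cancel₀ h2
    rw [rchoose_succ, ← ih]
    have h3 := Ring.choose_smul_choose t (n := m + 1) (k := m) (by omega)
    simp at h3
    linarith

lemma summable_rchoose (t : ℝ) (ht : 0 < t) : Summable fun m => |rchoose t m| := by
  obtain ⟨M, hM⟩ := exists_nat_ge t
  rw [← summable_nat_add_iff M]
  have key : ∀ n : ℕ, t * ∑ i ∈ Finset.range n, |rchoose t (i + M)|
      = M * |rchoose t M| - (n + M) * |rchoose t (n + M)| := by
    intro n
    induction n with
    | zero => simp
    | succ n ih =>
      rw [Finset.sum_range_succ, mul_add, ih]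
      have h := congrArg abs (rchoose_succ t (n + M))
      rw [abs_mul, abs_mul] at h
      push_cast at h
      rw [abs_of_nonneg (by positivity : (0 : ℝ) ≤ (n : ℝ) + M + 1),
        abs_of_nonpos (by have : (0 : ℝ) ≤ n := by positivity
                          linarith : t - ((n : ℝ) + M) ≤ 0)] at h
      rw [show n + 1 + M = n + M + 1 by ring]
      push_cast
      linarith
  refine summable_of_sum_range_le (c := M * |rchoose t M| / t) (fun _ => abs_nonneg _) fun n => ?_
  rw [le_div_iff₀ ht, mul_comm, key]
  have : 0 ≤ ((n : ℝ) + M) * |rchoose t (n + M)| := by positivity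
  linarith

lemma summable_signed (t : ℝ) (ht : 0 < t) (j : ℕ) :
    Summable fun ν : ℕ => (-1 : ℝ) ^ ν * rchoose t (ν + j) := by
  refine Summable.of_norm_bounded ((summable_nat_add_iff j).2 (summable_rchoose t ht)) fun ν => ?_
  simp

lemma summable_main (t : ℝ) (ht : 0 < t) (j : ℕ) :
    Summable fun ν : ℕ => ((-1:ℝ) ^ (ν + 1) / (ν + 1)) * rchoose t ((ν + 1) + j) := by
  refine Summable.of_norm_bounded
    ((summable_nat_add_iff (1 + j)).2 (summable_rchoose t ht)) fun ν => ?_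
  rw [show ν + (1 + j) = ν + 1 + j by ring, norm_mul]
  refine mul_le_of_le_one_left (abs_nonneg _) ?_
  rw [norm_div, norm_pow, norm_neg, norm_one, one_pow]
  have : (1 : ℝ) ≤ ‖(ν : ℝ) + 1‖ := by
    rw [Real.norm_of_nonneg (by positivity)]
    have : (0 : ℝ) ≤ ν := by positivity
    linarith
  exact div_le_one_of_le₀ this (by positivity)

lemma hasSum_tele (b : ℕ → ℝ) (hb : Summable b) : HasSum (fun n => b (n + 1) - b n) (-b 0) := by
  have h1 : Summable fun n => b (n + 1) := (summable_nat_add_iff 1).2 hb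
  have := h1.hasSum.sub hb.hasSum
  rw [hb.tsum_eq_zero_add] at this
  rw [show (-b 0) = ∑' n, b (n + 1) - (b 0 + ∑' n, b (n + 1)) by ring]
  exact this

noncomputable def hS (t : ℝ) (j : ℕ) : ℝ :=
  ∑' ν : ℕ, ((-1:ℝ) ^ (ν + 1) / (ν + 1)) * rchoose t ((ν + 1) + j)

lemma hS_succ (t : ℝ) (ht : 0 < t) (j : ℕ) :
    ((j : ℝ) + 1) * hS t (j + 1) = (t - j) * hS t j + rchoose t (j + 1) := by
  have h1 := (summable_main t ht (j + 1)).hasSum.mul_left ((j : ℝ) + 1)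
  have h2 := (summable_main t ht j).hasSum.mul_left (t - j)
  have h3 := hasSum_tele _ (summable_signed t ht (j + 1))
  have h4 := h2.sub h3
  have h5 : (fun ν : ℕ => ((j : ℝ) + 1) *
      (((-1:ℝ) ^ (ν + 1) / (ν + 1)) * rchoose t ((ν + 1) + (j + 1)))) =
      fun ν : ℕ => (t - j) * (((-1:ℝ) ^ (ν + 1) / (ν + 1)) * rchoose t ((ν + 1) + j)) -
      ((-1 : ℝ) ^ (ν + 1) * rchoose t ((ν + 1) + (j + 1)) -
        (-1 : ℝ) ^ ν * rchoose t (ν + (j + 1))) := by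
    funext ν
    have h := rchoose_succ t (ν + 1 + j)
    push_cast at h
    rw [show ν + (j + 1) = ν + 1 + j by ring, show ν + 1 + (j + 1) = ν + 1 + j + 1 by ring]
    have h2 : ((ν : ℝ) + 1) ≠ 0 := by positivity
    field_simp
    rw [pow_succ]
    linear_combination (-(-1 : ℝ) ^ ν) * h
  rw [h5] at h1
  have h6 := h1.unique h4
  simp only [pow_zero, zero_add, one_mul] at h6
  unfold hS
  linarith

lemma hS_shift (t : ℝ) (ht : 0 < t) : hS (t + 1) 0 = hS t 0 - 1 / (t + 1) := by
  have h1 := (summable_main t ht 0).hasSum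
  have h2 := (summable_main (t + 1) (by linarith) 0).hasSum
  have h3 := (hasSum_tele _ (summable_signed t ht 0)).div_const (t + 1)
  have h4 := h1.add h3
  have h5 : (fun ν : ℕ => ((-1:ℝ) ^ (ν + 1) / (ν + 1)) * rchoose (t + 1) ((ν + 1) + 0)) =
      fun ν : ℕ => ((-1:ℝ) ^ (ν + 1) / (ν + 1)) * rchoose t ((ν + 1) + 0) +
      ((-1 : ℝ) ^ (ν + 1) * rchoose t ((ν + 1) + 0) -
        (-1 : ℝ) ^ ν * rchoose t (ν + 0)) / (t + 1) := by
    funext ν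
    simp only [add_zero]
    have h := rchoose_absorb t ν
    have h' := rchoose_pascal t ν
    have h2 : ((ν : ℝ) + 1) ≠ 0 := by positivity
    have h3 : t + 1 ≠ 0 := by positivity
    have h6 : rchoose t (ν + 1) = rchoose (t + 1) (ν + 1) - rchoose t ν := by linarith
    rw [h6]
    field_simp
    rw [pow_succ]
    linear_combination ((-1 : ℝ) ^ ν) * h
  rw [h5] at h2
  have h6 := h2.unique h4
  rw [← h5] at h6
  simp only [pow_zero, zero_add, one_mul, rchoose_zero] at h6
  unfold hS
  simp only [add_zero] at h6 ⊢
  rw [h6]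
  ring

lemma hasSum_binom (t x : ℝ) (hx : |x| < 1) :
    HasSum (fun n : ℕ => rchoose t n * (-x) ^ n) ((1 - x) ^ t) := by
  have h := (Real.one_add_rpow_hasFPowerSeriesOnBall_zero (a := t)).hasSum (y := -x)
    (by simpa [enorm_eq_nnnorm, ← NNReal.coe_lt_coe] using hx)
  simpa only [binomialSeries_apply, rchoose_eq_ring, zero_add, ← sub_eq_add_neg 1 x, List.ofFn_const,
    List.prod_replicate, smul_eq_mul] using h

noncomputable def gS (t x : ℝ) : ℝ :=
  ∑' ν : ℕ, ((-1:ℝ) ^ (ν + 1) / (ν + 1)) * rchoose t ((ν + 1) + 0) * x ^ (ν + 1)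

lemma gS_cont (t : ℝ) (ht : 0 < t) : ContinuousOn (gS t) (Set.Icc 0 1) := by
  refine continuousOn_tsum (fun i => by fun_prop) (summable_main t ht 0).norm ?_
  intro n x hx
  rw [norm_mul]
  refine mul_le_of_le_one_right (norm_nonneg _) ?_
  rw [norm_pow, Real.norm_of_nonneg hx.1]
  exact pow_le_one₀ hx.1 hx.2

lemma gS_deriv (t : ℝ) (ht : 0 < t) (x : ℝ) (hx : x ∈ Set.Ioo (0 : ℝ) 1) :
    HasDerivAt (gS t) (((1 - x) ^ t - 1) / x) x := by
  have hsum : Summable fun ν : ℕ => |rchoose t (ν + 1)| :=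
    (summable_nat_add_iff 1).2 (summable_rchoose t ht)
  have h := hasDerivAt_tsum_of_isPreconnected
    (g := fun (ν : ℕ) (x : ℝ) =>
      ((-1:ℝ) ^ (ν + 1) / (ν + 1)) * rchoose t ((ν + 1) + 0) * x ^ (ν + 1))
    (g' := fun (ν : ℕ) (x : ℝ) => (-1:ℝ) ^ (ν + 1) * rchoose t (ν + 1) * x ^ ν)
    (y₀ := 0) (y := x) hsum (isOpen_Ioo (a := (-1 : ℝ)) (b := 1)) isPreconnected_Ioo
    ?_ ?_ (by constructor <;> norm_num) ?_ ⟨by linarith [hx.1], hx.2⟩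
  · suffices hh : ((1 - x) ^ t - 1) / x =
        ∑' n : ℕ, (-1:ℝ) ^ (n + 1) * rchoose t (n + 1) * x ^ n by
      rw [hh]
      exact h
    have h1 := hasSum_binom t x (by rw [abs_lt]; constructor <;> linarith [hx.1, hx.2])
    have h2 := (hasSum_nat_add_iff' 1).2 h1
    simp only [Finset.sum_range_one, pow_zero, rchoose_zero, mul_one] at h2
    have h3 := h2.div_const x
    rw [← h3.tsum_eq]
    refine tsum_congr fun n => ?_
    have := hx.1.ne'
    rw [neg_pow x]
    field_simp
    ring
  · intro n y _
    have h2 : ((n : ℝ) + 1) ≠ 0 := by positivity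
    have := (hasDerivAt_pow (n + 1) y).const_mul
      (((-1:ℝ) ^ (n + 1) / (n + 1)) * rchoose t ((n + 1) + 0))
    have e : (-1:ℝ) ^ (n + 1) * rchoose t (n + 1) * y ^ n =
        ((-1:ℝ) ^ (n + 1) / (n + 1)) * rchoose t ((n + 1) + 0) *
          (((n + 1 : ℕ) : ℝ) * y ^ (n + 1 - 1)) := by
      simp only [add_zero, Nat.add_sub_cancel]
      push_cast
      field_simp
    simp only [e]
    exact this
  · intro n y hy
    have : |y| ≤ 1 := abs_le.2 ⟨hy.1.le, hy.2.le⟩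
    simp only [norm_mul, norm_pow, norm_neg, norm_one, one_pow, one_mul, Real.norm_eq_abs]
    exact mul_le_of_le_one_right (abs_nonneg _) (pow_le_one₀ (abs_nonneg _) this)
  · simp

lemma hS_anti (s t : ℝ) (hs : 0 < s) (hst : s ≤ t) : hS t 0 ≤ hS s 0 := by
  have ht : 0 < t := hs.trans_le hst
  have hm : MonotoneOn (fun x => gS s x - gS t x) (Set.Icc 0 1) := by
    refine monotoneOn_of_deriv_nonneg (convex_Icc 0 1) ((gS_cont s hs).sub (gS_cont t ht)) ?_ ?_
    · rw [interior_Icc]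
      intro x hx
      exact ((gS_deriv s hs x hx).sub (gS_deriv t ht x hx)).differentiableAt.differentiableWithinAt
    · rw [interior_Icc]
      intro x hx
      have h := ((gS_deriv s hs x hx).sub (gS_deriv t ht x hx)).deriv
      have h' : deriv (fun x => gS s x - gS t x) x = _ := h
      rw [h', ← sub_div]
      refine div_nonneg ?_ hx.1.le
      have := Real.rpow_le_rpow_of_exponent_ge (x := 1 - x) (by linarith [hx.2])
        (by linarith [hx.1]) hst
      linarith
  have h := hm (Set.left_mem_Icc.2 zero_le_one) (Set.right_mem_Icc.2 zero_le_one) zero_le_one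
  have h0 : ∀ r, gS r 0 = 0 := fun r => by simp [gS]
  have h1 : ∀ r, gS r 1 = hS r 0 := fun r => by simp [gS, hS]
  simp only [h0, h1] at h
  linarith

lemma diffAt_logGamma (x : ℝ) (hx : 0 < x) :
    DifferentiableAt ℝ (fun y => Real.log (Real.Gamma y)) x := by
  refine (Real.differentiableAt_Gamma fun m => ?_).log (Real.Gamma_pos_of_pos hx).ne'
  have : (0 : ℝ) ≤ m := by positivity
  linarith

lemma digamma_mono (x y : ℝ) (hx : 0 < x) (hxy : x ≤ y) : digamma x ≤ digamma y :=
  Real.convexOn_log_Gamma.monotoneOn_deriv (fun x hx => diffAt_logGamma x hx)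
    hx (hx.trans_le hxy) hxy

lemma digamma_succ (x : ℝ) (hx : 0 < x) : digamma (x + 1) = digamma x + 1 / x := by
  unfold digamma
  rw [← deriv_comp_add_const]
  have h : (fun y => Real.log (Real.Gamma (y + 1))) =ᶠ[nhds x]
      fun y => Real.log (Real.Gamma y) + Real.log y := by
    filter_upwards [lt_mem_nhds hx] with y hy
    rw [Real.Gamma_add_one hy.ne', Real.log_mul hy.ne' (Real.Gamma_pos_of_pos hy).ne', add_comm]
  rw [h.deriv_eq]
  have := ((diffAt_logGamma x hx).hasDerivAt.add (Real.hasDerivAt_log hx.ne')).deriv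
  rw [one_div]
  exact this

lemma shift_bound (f : ℝ → ℝ) (hf : ∀ x, 0 < x → f (x + 1) = f x + 1 / (x + 1)) (K : ℕ)
    (x : ℝ) (hx : 0 < x) : f (x + K) ≤ f x + K / x := by
  induction K with
  | zero => simp
  | succ K ih =>
    push_cast
    rw [← add_assoc, hf _ (by positivity), add_div]
    have : 1 / (x + K + 1) ≤ 1 / x := by
      apply one_div_le_one_div_of_le hx
      have : (0 : ℝ) ≤ K := by positivity
      linarith
    linarith

lemma uniq (f g : ℝ → ℝ) (hf : ∀ x, 0 < x → f (x + 1) = f x + 1 / (x + 1))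
    (hg : ∀ x, 0 < x → g (x + 1) = g x + 1 / (x + 1))
    (mf : ∀ x y, 0 < x → x ≤ y → f x ≤ f y) (mg : ∀ x y, 0 < x → x ≤ y → g x ≤ g y)
    (t : ℝ) (ht : 0 < t) : f t - g t = f 1 - g 1 := by
  obtain ⟨K, hK⟩ := exists_nat_ge t
  have per : ∀ x, 0 < x → ∀ n : ℕ, f (x + n) - g (x + n) = f x - g x := by
    intro x hx n
    induction n with
    | zero => simp
    | succ n ih =>
      push_cast
      rw [← add_assoc, hf _ (by positivity), hg _ (by positivity), ← ih]
      ring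
  have key : ∀ n : ℕ, |(f t - g t) - (f 1 - g 1)| ≤ (K + 1 : ℕ) / ((n : ℝ) + 1) := by
    intro n
    have hn : (0 : ℝ) < (n : ℝ) + 1 := by positivity
    have h1 := per t ht (n + 1)
    have h2 := per 1 one_pos n
    push_cast at h1
    rw [add_comm 1 (n : ℝ)] at h2
    have bf := shift_bound f hf (K + 1) _ hn
    have bg := shift_bound g hg (K + 1) _ hn
    have le1 : (n : ℝ) + 1 ≤ t + (n + 1) := by linarith
    have le2 : t + ((n : ℝ) + 1) ≤ n + 1 + (K + 1 : ℕ) := by push_cast; linarith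
    have a1 := mf _ _ hn le1
    have a2 := mg _ _ hn le1
    have a3 := mf _ _ (hn.trans_le le1) le2
    have a4 := mg _ _ (hn.trans_le le1) le2
    rw [abs_le]
    constructor <;> linarith
  have lim : Filter.Tendsto (fun n : ℕ => ((K + 1 : ℕ) : ℝ) / ((n : ℝ) + 1)) Filter.atTop
      (nhds 0) := by
    have := (tendsto_one_div_add_atTop_nhds_zero_nat (𝕜 := ℝ)).const_mul ((K + 1 : ℕ) : ℝ)
    simpa [div_eq_mul_inv] using this
  have := ge_of_tendsto' lim key
  have := abs_nonpos_iff.1 this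
  linarith

lemma hS_one : hS 1 0 = -1 := by
  unfold hS
  rw [tsum_eq_single 0]
  · simp [rchoose]
  · intro n hn
    have : rchoose 1 (n + 1 + 0) = 0 := by
      unfold rchoose
      rw [Finset.prod_eq_zero (i := 1) (by simp; omega) (by simp)]
      simp
    rw [this, mul_zero]

lemma hS_eq (t : ℝ) (ht : 0 < t) (j : ℕ) :
    hS t j = rchoose t j * (digamma (j + 1) - digamma (t + 1)) := by
  induction j with
  | zero =>
    have h := uniq (fun x => -hS x 0) (fun x => digamma (x + 1))
      (fun x hx => by rw [hS_shift x hx]; ring)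
      (fun x hx => digamma_succ (x + 1) (by positivity))
      (fun x y hx hxy => neg_le_neg (hS_anti x y hx hxy))
      (fun x y hx hxy => digamma_mono _ _ (by positivity) (by linarith)) t ht
    simp only [hS_one, digamma_succ 1 one_pos] at h
    simp only [rchoose_zero, Nat.cast_zero, zero_add]
    linarith
  | succ j ih =>
    have h2 : ((j : ℝ) + 1) ≠ 0 := by positivity
    apply mul_left_cancel₀ h2
    rw [hS_succ t ht, ih]
    push_cast
    rw [digamma_succ ((j : ℝ) + 1) (by positivity)]
    have h := rchoose_succ t j
    have h3 : rchoose t (j + 1) = ((j : ℝ) + 1) * rchoose t (j + 1) * (1 / (j + 1)) := by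
      field_simp
    linear_combination h3 - (digamma (j + 1) - digamma (t + 1)) * h

theorem sum_binomial_digamma (t : ℝ) (ht : 0 < t) (j : ℕ) :
    ∑' ν : ℕ, ((-1:ℝ) ^ (ν + 1) / (ν + 1)) * rchoose t ((ν + 1) + j)
      = rchoose t j * (digamma (j + 1) - digamma (t + 1)) := by
  exact hS_eq t ht j
end

section
/- The integral from 0 to 1 of t·ln Γ(t) dt equals ζ'(2)/(2π²) + (1/6)·ln(2π) - γ/12, where ζ' is the derivative of the Riemann zeta function and γ is the Euler–Mascheroni constant. -/
open Real
open Filter Topology MeasureTheory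
open scoped FourierTransform

namespace ITLG

/-- The kernel `(1 - cos (2 π v)) / v`. -/
noncomputable def K (v : ℝ) : ℝ := 2 * sin (π * v) ^ 2 / v

lemma K_eq (v : ℝ) : K v = 2 * π * sin (π * v) * sinc (π * v) := by
  unfold K
  by_cases hv : v = 0
  · simp [hv]
  · rw [sinc_of_ne_zero (by positivity)]
    field_simp

lemma continuous_K : Continuous K := by
  have : K = fun v => 2 * π * sin (π * v) * sinc (π * v) := funext K_eq
  rw [this]
  have := continuous_sinc
  fun_prop

noncomputable def G (M : ℕ) : ℝ := ∫ v in (0:ℝ)..M, K v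

lemma sum_sin (N : ℕ) (x : ℝ) :
    sin x * ∑ k ∈ Finset.range N, sin ((2 * k + 1) * x) = sin (N * x) ^ 2 := by
  induction N with
  | zero => simp
  | succ N ih =>
    rw [Finset.sum_range_succ, mul_add, ih]
    have e1 : ((2:ℝ) * N + 1) * x = N * x + (N * x + x) := by ring
    have e2 : ((N + 1 : ℕ) : ℝ) * x = N * x + x := by push_cast; ring
    rw [e1, e2, sin_add (N * x) (N * x + x), sin_add, cos_add]
    have h1 := sin_sq_add_cos_sq (N * x)
    have h2 := sin_sq_add_cos_sq x
    rw [← sub_eq_zero]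
    have : sin (N * x) ^ 2 + sin x * (sin (N * x) * (cos (N * x) * cos x - sin (N * x) * sin x) +
        cos (N * x) * (sin (N * x) * cos x + cos (N * x) * sin x)) -
        (sin (N * x) * cos x + cos (N * x) * sin x) ^ 2 =
        sin (N*x)^2 * (1 - (sin x ^ 2 + cos x ^ 2)) := by ring
    rw [this, h2]; ring

lemma integral_sin_odd (k : ℕ) : ∫ x in (0:ℝ)..(π/2), sin ((2 * k + 1) * x) = 1 / (2 * k + 1) := by
  have hc : ((2:ℝ) * k + 1) ≠ 0 := by positivity
  rw [intervalIntegral.integral_comp_mul_left (fun x => sin x) hc, integral_sin]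
  have : ((2:ℝ) * k + 1) * (π / 2) = π / 2 + k * π := by ring
  rw [this, cos_add_nat_mul_pi]
  simp

lemma integral_sin_sq_div_sin (N : ℕ) :
    ∫ x in (0:ℝ)..(π/2), sin (N * x) ^ 2 / sin x = ∑ k ∈ Finset.range N, 1 / (2 * (k:ℝ) + 1) := by
  rw [← Finset.sum_congr rfl (fun k _ => integral_sin_odd k),
    ← intervalIntegral.integral_finsetSum]
  · apply intervalIntegral.integral_congr
    intro x hx
    rw [Set.uIcc_of_le (by positivity)] at hx
    dsimp only
    rcases hx.1.eq_or_lt with h0 | h0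
    · simp [← h0]
    · have : sin x ≠ 0 := (sin_pos_of_pos_of_lt_pi h0 (by linarith [hx.2, pi_pos])).ne'
      rw [div_eq_iff this, ← sum_sin]; ring
  · intro k _
    apply Continuous.intervalIntegrable
    fun_prop

noncomputable def g (x : ℝ) : ℝ := 1 / sin x - 1 / x

noncomputable def Φ (x : ℝ) : ℝ := log (sinc (x / 2)) - log (cos (x / 2))

lemma Φ_cont : ContinuousOn Φ (Set.Icc 0 (π / 2)) := by
  have hs := continuous_sinc
  unfold Φ
  apply ContinuousOn.sub
  · apply ContinuousOn.log (by fun_prop)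
    intro x hx
    rcases hx.1.eq_or_lt with h0 | h0
    · simp [← h0]
    · rw [sinc_of_ne_zero (by positivity)]
      have : 0 < sin (x / 2) := sin_pos_of_pos_of_lt_pi (by positivity) (by linarith [hx.2, pi_pos])
      positivity
  · apply ContinuousOn.log (by fun_prop)
    intro x hx
    exact (cos_pos_of_mem_Ioo ⟨by linarith [hx.1, pi_pos], by linarith [hx.2, pi_pos]⟩).ne'

lemma Φ_deriv (x : ℝ) (hx : x ∈ Set.Ioo 0 (π/2)) : HasDerivAt Φ (g x) x := by
  have h0 := hx.1
  have hs : 0 < sin (x / 2) := sin_pos_of_pos_of_lt_pi (by positivity) (by linarith [hx.2, pi_pos])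
  have hc : 0 < cos (x / 2) := cos_pos_of_mem_Ioo ⟨by linarith [hx.1, pi_pos], by linarith [hx.2, pi_pos]⟩
  have hd : HasDerivAt (fun y : ℝ => y / 2) (1 / 2) x := (hasDerivAt_id x).div_const 2
  have key : HasDerivAt (fun y => log (sin (y / 2)) - log (y / 2) - log (cos (y / 2)))
      (cos (x/2) * (1/2) / sin (x/2) - (1/2) / (x/2) - (-sin (x/2) * (1/2)) / cos (x/2)) x :=
    ((hd.sin.log hs.ne').sub (hd.log (by positivity))).sub (hd.cos.log hc.ne')
  have e : g x = cos (x/2) * (1/2) / sin (x/2) - (1/2) / (x/2) - (-sin (x/2) * (1/2)) / cos (x/2) := by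
    unfold g
    have e2 : sin x = 2 * sin (x/2) * cos (x/2) := by rw [← sin_two_mul]; ring_nf
    rw [e2]
    have := sin_sq_add_cos_sq (x/2)
    field_simp
    linear_combination (-x) * this
  rw [e]
  refine key.congr_of_eventuallyEq ?_
  filter_upwards [Ioo_mem_nhds hx.1 hx.2] with y hy
  have hy0 := hy.1
  have hs : 0 < sin (y / 2) := sin_pos_of_pos_of_lt_pi (by positivity) (by linarith [hy.2, pi_pos])
  unfold Φ
  rw [sinc_of_ne_zero (by positivity), log_div hs.ne' (by positivity)]

lemma g_nonneg (x : ℝ) (hx : x ∈ Set.Ioo 0 (π/2)) : 0 ≤ g x := by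
  have h0 := hx.1
  have hs : 0 < sin x := sin_pos_of_pos_of_lt_pi (by positivity) (by linarith [hx.2, pi_pos])
  unfold g
  rw [sub_nonneg]
  exact one_div_le_one_div_of_le hs (sin_le h0.le)

lemma g_int : IntervalIntegrable g volume 0 (π/2) := by
  rw [intervalIntegrable_iff_integrableOn_Ioc_of_le (by positivity)]
  exact intervalIntegral.integrableOn_deriv_of_nonneg Φ_cont Φ_deriv g_nonneg

lemma integral_g : ∫ x in (0:ℝ)..(π/2), g x = log (4 / π) := by
  rw [intervalIntegral.integral_eq_sub_of_hasDerivAt_of_le (by positivity) Φ_cont Φ_deriv g_int]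
  have e : π / 2 / 2 = π / 4 := by ring
  have h1 : Φ (π/2) = log (4/π) := by
    unfold Φ
    rw [e, sinc_of_ne_zero (by positivity), sin_pi_div_four, cos_pi_div_four,
      log_div (by positivity) (by positivity), log_div (by positivity : π ≠ 0) (by positivity),
      log_div (by norm_num : (4:ℝ) ≠ 0) (by positivity)]
    ring
  rw [h1]
  simp [Φ]

lemma RL : Tendsto (fun M : ℕ => ∫ x in (0:ℝ)..(π/2), cos (4 * M * x) * g x) atTop (𝓝 0) := by
  have h := Real.tendsto_integral_exp_smul_cocompact
    (fun x => (Set.indicator (Set.Ioc 0 (π/2)) (fun x => ((g x : ℝ) : ℂ)) x))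
  have hw : Tendsto (fun M : ℕ => (2 / π) * (M : ℝ)) atTop (cocompact ℝ) := by
    refine Tendsto.mono_right ?_ atTop_le_cocompact
    exact Tendsto.const_mul_atTop (by positivity) tendsto_natCast_atTop_atTop
  have h2 := (Complex.continuous_re.tendsto 0).comp (h.comp hw)
  simp only [Complex.zero_re] at h2
  refine h2.congr fun M => ?_
  simp only [Function.comp_apply]
  rw [intervalIntegral.integral_of_le (by positivity), ← integral_indicator measurableSet_Ioc]
  have hgi : Integrable (Set.indicator (Set.Ioc 0 (π/2)) (fun x => ((g x : ℝ) : ℂ))) := by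
    rw [integrable_indicator_iff measurableSet_Ioc]
    exact ((intervalIntegrable_iff_integrableOn_Ioc_of_le (by positivity)).1 g_int).ofReal
  have hi : Integrable (fun v : ℝ => 𝐞 (-(v * ((2 / π) * (M : ℝ)))) •
      (Set.indicator (Set.Ioc 0 (π/2)) (fun x => ((g x : ℝ) : ℂ)) v)) := by
    have := (Real.fourierIntegral_convergent_iff (f := Set.indicator (Set.Ioc 0 (π/2)) (fun x => ((g x : ℝ) : ℂ))) (μ := volume) ((2 / π) * (M : ℝ))).2 hgi
    simpa [mul_comm] using this
  have := integral_re hi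
  simp only [RCLike.re_to_complex] at this
  rw [← this]
  congr 1
  ext v
  by_cases hv : v ∈ Set.Ioc 0 (π/2)
  · simp only [Set.indicator_of_mem hv, Circle.smul_def, Real.fourierChar_apply, smul_eq_mul]
    rw [Complex.re_mul_ofReal, Complex.exp_ofReal_mul_I_re]
    congr 1
    rw [← cos_neg]
    congr 1
    field_simp
    ring
  · simp [Set.indicator_of_notMem hv]

lemma G_eq (M : ℕ) : G M = 2 * ∑ k ∈ Finset.range (2 * M), 1 / (2 * (k:ℝ) + 1)
    - log (4 / π) + ∫ x in (0:ℝ)..(π/2), cos (4 * M * x) * g x := by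
  have hcos : IntervalIntegrable (fun x => cos (4 * M * x) * g x) volume 0 (π/2) :=
    g_int.continuousOn_mul (by fun_prop)
  have hss : IntervalIntegrable (fun x => sin ((2 * M : ℕ) * x) ^ 2 / sin x) volume 0 (π/2) := by
    have : IntervalIntegrable (fun x => ∑ k ∈ Finset.range (2 * M), sin ((2 * k + 1) * x)) volume 0 (π/2) := by
      apply Continuous.intervalIntegrable
      fun_prop
    refine this.congr ?_
    intro x hx
    rw [Set.uIoc_of_le (by positivity)] at hx
    dsimp only
    have : sin x ≠ 0 := (sin_pos_of_pos_of_lt_pi hx.1 (by linarith [hx.2, pi_pos])).ne'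
    rw [eq_div_iff this, ← sum_sin]; ring
  have e1 : G M = ∫ x in (0:ℝ)..(π/2), (2 * (sin ((2 * M : ℕ) * x) ^ 2 / sin x) - g x + cos (4 * M * x) * g x) := by
    have := intervalIntegral.smul_integral_comp_mul_left (a := 0) (b := π/2) K (2 * M / π)
    have e : 2 * M / π * (π / 2) = (M : ℝ) := by field_simp
    rw [e, mul_zero] at this
    rw [G, ← this, smul_eq_mul, ← intervalIntegral.integral_const_mul]
    apply intervalIntegral.integral_congr
    intro x hx
    dsimp only
    have hc : cos (4 * M * x) = 1 - 2 * sin (2 * M * x) ^ 2 := by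
      have : 4 * M * x = 2 * (2 * M * x) := by ring
      rw [this, cos_two_mul, cos_sq']; ring
    rw [hc]
    unfold K g
    rcases Nat.eq_zero_or_pos M with hM | hM
    · simp [hM]
    by_cases hx0 : x = 0
    · simp [hx0]
    have : π * (2 * M / π * x) = 2 * M * x := by field_simp
    rw [this]
    push_cast
    field_simp
    ring
  rw [e1, intervalIntegral.integral_add ((hss.const_mul 2).sub g_int) hcos,
    intervalIntegral.integral_sub (hss.const_mul 2) g_int, intervalIntegral.integral_const_mul,
    integral_sin_sq_div_sin, integral_g]

lemma sum_odd (N : ℕ) : 2 * ∑ k ∈ Finset.range N, 1 / (2 * (k:ℝ) + 1) = 2 * (harmonic (2 * N) : ℝ) - harmonic N := by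
  induction N with
  | zero => simp
  | succ N ih =>
    rw [Finset.sum_range_succ, mul_add, ih, show 2 * (N + 1) = 2 * N + 1 + 1 by ring,
      harmonic_succ, harmonic_succ, harmonic_succ]
    push_cast
    field_simp
    ring

lemma G_lim : Tendsto (fun M : ℕ => G M - log M) atTop (𝓝 (eulerMascheroniConstant + log (2 * π))) := by
  have h4 := tendsto_harmonic_sub_log.comp (tendsto_id.const_mul_atTop' (show 0 < 4 by norm_num))
  have h2 := tendsto_harmonic_sub_log.comp (tendsto_id.const_mul_atTop' (show 0 < 2 by norm_num))
  have h := (((h4.const_mul 2).sub h2).add RL).add_const (log 8 - log (4 / π))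
  have e : 2 * eulerMascheroniConstant - eulerMascheroniConstant + 0 + (log 8 - log (4 / π)) =
      eulerMascheroniConstant + log (2 * π) := by
    rw [← log_div (by norm_num) (by positivity)]
    have : 8 / (4 / π) = 2 * π := by field_simp; norm_num
    rw [this]; ring
  rw [e] at h
  refine h.congr' ?_
  filter_upwards [eventually_gt_atTop 0] with M hM
  have hM' : (0:ℝ) < M := by exact_mod_cast hM
  simp only [Function.comp_apply, id]
  rw [G_eq, sum_odd, show 2 * (2 * M) = 4 * M by ring]
  push_cast
  rw [log_mul (by norm_num) hM'.ne', log_mul (by norm_num) hM'.ne',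
    show (8:ℝ) = 2 ^ 3 by norm_num, show log (4:ℝ) = log (2 ^ 2) by norm_num, log_pow, log_pow]
  push_cast
  ring


lemma log_zeta : HasSum (fun n : ℕ => 1 / (n:ℝ) ^ 2 * log n) (-(deriv riemannZeta 2).re) := by
  have hab : LSeries.abscissaOfAbsConv 1 < ((2:ℂ).re : EReal) := by
    rw [LSeries.abscissaOfAbsConv_one]
    norm_num
    exact_mod_cast (one_lt_two : (1:ℝ) < 2)
  have hd := LSeries_hasDerivAt hab
  have hs := (LSeriesSummable_logMul_of_lt_re hab).hasSum
  have he : riemannZeta =ᶠ[𝓝 2] LSeries 1 := by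
    have : {s : ℂ | 1 < s.re} ∈ 𝓝 (2:ℂ) :=
      (isOpen_lt continuous_const Complex.continuous_re).mem_nhds (by simp)
    filter_upwards [this] with s hs
    exact (LSeries_one_eq_riemannZeta hs).symm
  have hz : deriv riemannZeta 2 = -LSeries (LSeries.logMul 1) 2 := by
    rw [he.deriv_eq, hd.deriv]
  rw [hz]
  have := Complex.hasSum_re hs
  rw [Complex.neg_re, neg_neg]
  convert! this using 1
  ext n
  rcases Nat.eq_zero_or_pos n with hn | hn
  · simp [hn]
  · rw [LSeries.term_of_ne_zero hn.ne', LSeries.logMul]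
    rw [← Complex.natCast_log]
    have : ((n:ℂ) ^ (2:ℂ)) = (((n:ℝ) ^ 2 : ℝ) : ℂ) := by
      rw [show (2:ℂ) = ((2:ℕ):ℂ) by norm_num, Complex.cpow_natCast]; push_cast; rfl
    rw [this]
    simp only [Pi.one_apply, mul_one]
    rw [← Complex.ofReal_div, Complex.ofReal_re]
    ring

lemma G_zero : G 0 = 0 := by simp [G]

lemma G_bound : ∃ C : ℝ, 0 ≤ C ∧ ∀ M : ℕ, |G M - log M| ≤ C := by
  obtain ⟨C, hC⟩ := (Metric.isBounded_range_of_tendsto _ G_lim).exists_norm_le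
  exact ⟨C, (norm_nonneg _).trans (hC _ ⟨0, rfl⟩), fun M => hC _ ⟨M, rfl⟩⟩

lemma G_sub_log_summable_bound {C : ℝ} :
    Summable (fun n : ℕ => 1 / (n:ℝ) ^ 2 * (C + log n)) := by
  have h := (hasSum_zeta_two.summable.mul_right C).add log_zeta.summable
  refine h.congr fun n => ?_
  ring

lemma summable_G (N : ℕ) : Summable (fun n : ℕ => 1 / (n:ℝ) ^ 2 * G (n * N)) := by
  obtain ⟨C, hC0, hC⟩ := G_bound
  rcases Nat.eq_zero_or_pos N with hN | hN
  · simp [hN, G_zero, summable_zero]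
  refine Summable.of_norm_bounded (G_sub_log_summable_bound (C := C + log N)) fun n => ?_
  rcases Nat.eq_zero_or_pos n with hn | hn
  · simp [hn]
  rw [norm_mul, norm_eq_abs, norm_eq_abs, abs_of_nonneg (by positivity : (0:ℝ) ≤ 1 / (n:ℝ)^2)]
  gcongr
  have h := hC (n * N)
  have hl : log ((n * N : ℕ) : ℝ) = log n + log N := by
    push_cast; exact log_mul (by positivity) (by positivity)
  have h0 : 0 ≤ log ((n * N : ℕ) : ℝ) := log_natCast_nonneg _
  rw [hl] at h h0
  rw [abs_le] at h ⊢
  constructor <;> linarith [h.1, h.2]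

lemma K_nonneg {v : ℝ} (hv : 0 ≤ v) : 0 ≤ K v := by unfold K; positivity

lemma integral_sin_sq_shift (n m : ℕ) :
    ∫ t in (0:ℝ)..1, 2 * sin (π * n * t) ^ 2 / (t + m) = G (n * (m + 1)) - G (n * m) := by
  have hii : ∀ a b : ℝ, IntervalIntegrable K volume a b := fun a b => continuous_K.intervalIntegrable a b
  unfold G
  rw [intervalIntegral.integral_interval_sub_left (hii _ _) (hii _ _)]
  have h1 := intervalIntegral.smul_integral_comp_mul_left (a := (m:ℝ)) (b := m + 1) K (n:ℝ)
  have h2 := intervalIntegral.integral_comp_add_right (a := 0) (b := 1) (fun t => K (n * t)) (m:ℝ)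
  push_cast
  rw [← h1, add_comm (m:ℝ) 1]
  rw [zero_add] at h2
  rw [← h2, smul_eq_mul, ← intervalIntegral.integral_const_mul]
  apply intervalIntegral.integral_congr
  intro t ht
  rw [Set.uIcc_of_le (by norm_num)] at ht
  dsimp only
  unfold K
  rcases Nat.eq_zero_or_pos n with hn | hn
  · simp [hn]
  have hsin : sin (π * (n * (t + m))) ^ 2 = sin (π * n * t) ^ 2 := by
    have : π * (n * (t + m)) = π * n * t + ((n * m : ℕ) : ℝ) * π := by push_cast; ring
    rw [this, sin_add_nat_mul_pi, mul_pow, ← pow_mul, mul_comm _ 2, pow_mul]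
    simp
  rw [hsin]
  by_cases h0 : t + m = 0
  · simp [h0]
  field_simp

lemma fourier_B2 {t : ℝ} (ht : t ∈ Set.Icc (0:ℝ) 1) :
    HasSum (fun n : ℕ => 1 / (n:ℝ) ^ 2 * (2 * sin (π * n * t) ^ 2)) (π ^ 2 * (t * (1 - t))) := by
  have h1 := hasSum_one_div_nat_pow_mul_cos (k := 1) one_ne_zero ht
  have h2 := hasSum_zeta_two.sub h1
  have e : (-1 : ℝ) ^ (1 + 1) * (2 * π) ^ (2 * 1) / 2 / (Nat.factorial (2 * 1)) *
        (Polynomial.map (algebraMap ℚ ℝ) (Polynomial.bernoulli (2 * 1))).eval t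
      = π ^ 2 * (t ^ 2 - t + 6⁻¹) := by
    have := bernoulliFun_two t
    rw [bernoulliFun] at this
    rw [mul_one, this, Nat.factorial_two]
    push_cast
    ring
  rw [e] at h2
  convert! h2 using 1
  · ext n
    have : 2 * π * n * t = 2 * (π * n * t) := by ring
    rw [this, cos_two_mul, cos_sq']
    simp only [mul_one]
    ring
  · ring

lemma hasSum_integral_B2 (m : ℕ) :
    HasSum (fun n : ℕ => 1 / (n:ℝ) ^ 2 * (G (n * (m + 1)) - G (n * m)))
      (π ^ 2 * ∫ t in (0:ℝ)..1, t * (1 - t) / (t + m)) := by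
  have hcont : ∀ n : ℕ, IntervalIntegrable (fun t : ℝ => 2 * sin (π * n * t) ^ 2 / (t + m)) volume 0 1 := by
    intro n
    have : IntervalIntegrable (fun t : ℝ => n * K (n * (t + m))) volume 0 1 := by
      apply Continuous.intervalIntegrable
      have := continuous_K
      fun_prop
    refine this.congr ?_
    intro t ht
    rw [Set.uIoc_of_le (by norm_num)] at ht
    dsimp only
    unfold K
    rcases Nat.eq_zero_or_pos n with hn | hn
    · simp [hn]
    have hsin : sin (π * (n * (t + m))) ^ 2 = sin (π * n * t) ^ 2 := by
      have : π * (n * (t + m)) = π * n * t + ((n * m : ℕ) : ℝ) * π := by push_cast; ring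
      rw [this, sin_add_nat_mul_pi, mul_pow, ← pow_mul, mul_comm _ 2, pow_mul]
      simp
    rw [hsin]
    have := ht.1
    have h0 : t + m ≠ 0 := by positivity
    field_simp
  have hI : ∀ n : ℕ, ∫ t in Set.Ioc (0:ℝ) 1, 1 / (n:ℝ) ^ 2 * (2 * sin (π * n * t) ^ 2 / (t + m)) =
      1 / (n:ℝ) ^ 2 * (G (n * (m + 1)) - G (n * m)) := by
    intro n
    rw [← intervalIntegral.integral_of_le (by norm_num), intervalIntegral.integral_const_mul,
      integral_sin_sq_shift]
  have hint : ∀ n : ℕ, Integrable (fun t : ℝ => 1 / (n:ℝ) ^ 2 * (2 * sin (π * n * t) ^ 2 / (t + m)))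
      (volume.restrict (Set.Ioc 0 1)) := fun n =>
    ((intervalIntegrable_iff_integrableOn_Ioc_of_le (by norm_num)).1 (hcont n)).const_mul _
  have hsum : Summable (fun n : ℕ => ∫ t in Set.Ioc (0:ℝ) 1,
      ‖1 / (n:ℝ) ^ 2 * (2 * sin (π * n * t) ^ 2 / (t + m))‖) := by
    have := (summable_G (m + 1)).sub (summable_G m)
    refine this.congr fun n => ?_
    rw [← mul_sub, ← hI n]
    apply setIntegral_congr_fun measurableSet_Ioc
    intro t ht
    have := ht.1
    exact (norm_of_nonneg (by positivity)).symm
  have h := hasSum_integral_of_summable_integral_norm hint hsum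
  simp_rw [hI] at h
  convert! h using 1
  rw [intervalIntegral.integral_of_le (by norm_num), ← integral_const_mul]
  apply setIntegral_congr_fun measurableSet_Ioc
  intro t ht
  have := (fourier_B2 ⟨ht.1.le, ht.2⟩).div_const (t + m)
  dsimp only
  rw [← mul_div_assoc, ← this.tsum_eq]
  congr 1
  ext n
  ring

lemma sum_integral_B2 (N : ℕ) :
    HasSum (fun n : ℕ => 1 / (n:ℝ) ^ 2 * G (n * N))
      (π ^ 2 * ∑ m ∈ Finset.range N, ∫ t in (0:ℝ)..1, t * (1 - t) / (t + m)) := by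
  rw [Finset.mul_sum]
  have := hasSum_sum (s := Finset.range N) (fun m _ => hasSum_integral_B2 m)
  convert! this using 1
  ext n
  rw [← Finset.mul_sum, Finset.sum_range_sub (fun m => G (n * m))]
  simp [G_zero]

lemma sum_lim : Tendsto (fun N : ℕ =>
    (π ^ 2 * ∑ m ∈ Finset.range N, ∫ t in (0:ℝ)..1, t * (1 - t) / (t + m)) - π ^ 2 / 6 * log N) atTop
    (𝓝 (π ^ 2 / 6 * (eulerMascheroniConstant + log (2 * π)) - (deriv riemannZeta 2).re)) := by
  obtain ⟨C, hC0, hC⟩ := G_bound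
  have hlim : ∑' n : ℕ, 1 / (n:ℝ) ^ 2 * (eulerMascheroniConstant + log (2 * π) + log n) =
      π ^ 2 / 6 * (eulerMascheroniConstant + log (2 * π)) - (deriv riemannZeta 2).re := by
    have := (hasSum_zeta_two.mul_right (eulerMascheroniConstant + log (2 * π))).add log_zeta
    rw [sub_eq_add_neg, ← this.tsum_eq]
    congr 1
    ext n
    ring
  rw [← hlim]
  have key : Tendsto (fun N : ℕ => ∑' n : ℕ, 1 / (n:ℝ) ^ 2 * (G (n * N) - log N)) atTop
      (𝓝 (∑' n : ℕ, 1 / (n:ℝ) ^ 2 * (eulerMascheroniConstant + log (2 * π) + log n))) := by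
    have hid : ∀ n N : ℕ, 0 < n → 0 < N →
        G (n * N) - log N = (G (n * N) - log ((n * N : ℕ) : ℝ)) + log n := by
      intro n N hn hN
      push_cast
      rw [log_mul (by positivity) (by positivity)]
      ring
    refine tendsto_tsum_of_dominated_convergence (G_sub_log_summable_bound (C := C)) ?_ ?_
    · intro n
      rcases Nat.eq_zero_or_pos n with hn | hn
      · simp [hn]
      have ht : Tendsto (fun N : ℕ => n * N) atTop atTop := tendsto_id.const_mul_atTop' hn
      have := ((G_lim.comp ht).add_const (log n)).const_mul (1 / (n:ℝ) ^ 2)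
      refine this.congr' ?_
      filter_upwards [eventually_gt_atTop 0] with N hN
      rw [hid n N hn hN]
      simp
    · filter_upwards [eventually_gt_atTop 0] with N hN n
      rcases Nat.eq_zero_or_pos n with hn | hn
      · simp [hn]
      rw [norm_mul, norm_eq_abs, norm_eq_abs, abs_of_nonneg (by positivity : (0:ℝ) ≤ 1 / (n:ℝ)^2)]
      gcongr
      rw [hid n N hn hN]
      refine (abs_add_le _ _).trans ?_
      rw [abs_of_nonneg (log_natCast_nonneg n)]
      gcongr
      exact hC _
  refine key.congr fun N => ?_
  have := (sum_integral_B2 N).sub (hasSum_zeta_two.mul_right (log N))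
  rw [← this.tsum_eq]
  congr 1
  ext n
  ring

lemma log_int (m : ℕ) : IntervalIntegrable (fun t : ℝ => log (t + m)) volume 0 1 := by
  have := (intervalIntegral.intervalIntegrable_log' (a := 0 + m) (b := 1 + m)).comp_add_right (m:ℝ)
  simpa using this

lemma parts (m : ℕ) : ∫ t in (0:ℝ)..1, (t - 1 / 2) * log (t + m) =
    1 / 2 * ∫ t in (0:ℝ)..1, t * (1 - t) / (t + m) := by
  have i1 : IntervalIntegrable (fun t : ℝ => (t - 1 / 2) * log (t + m)) volume 0 1 :=
    (log_int m).continuousOn_mul (by fun_prop)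
  have i2 : IntervalIntegrable (fun t : ℝ => t * (1 - t) / (t + m)) volume 0 1 := by
    rcases Nat.eq_zero_or_pos m with hm | hm
    · subst hm
      have : IntervalIntegrable (fun t : ℝ => 1 - t) volume 0 1 := by
        apply Continuous.intervalIntegrable
        fun_prop
      refine this.congr ?_
      intro t ht
      rw [Set.uIoc_of_le (by norm_num)] at ht
      have := ht.1
      simp only [Nat.cast_zero, add_zero]
      field_simp
    · apply ContinuousOn.intervalIntegrable
      apply ContinuousOn.div (by fun_prop) (by fun_prop)
      intro t ht
      rw [Set.uIcc_of_le (by norm_num)] at ht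
      have := ht.1
      positivity
  have hc : ContinuousOn (fun t : ℝ => 1 / 2 * (t ^ 2 - t) * log (t + m)) (Set.Icc 0 1) := by
    rcases Nat.eq_zero_or_pos m with hm | hm
    · subst hm
      have : (fun t : ℝ => 1 / 2 * (t ^ 2 - t) * log (t + (0:ℕ))) =
          fun t => 1 / 2 * (t - 1) * (t * log t) := by
        ext t
        simp only [Nat.cast_zero, add_zero]
        ring
      rw [this]
      have := Real.continuous_mul_log
      fun_prop
    · apply ContinuousOn.mul (by fun_prop)
      apply ContinuousOn.log (by fun_prop)
      intro t ht
      have := ht.1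
      positivity
  have hd : ∀ t ∈ Set.Ioo (0:ℝ) 1, HasDerivAt (fun t : ℝ => 1 / 2 * (t ^ 2 - t) * log (t + m))
      ((t - 1 / 2) * log (t + m) - 1 / 2 * (t * (1 - t) / (t + m))) t := by
    intro t ht
    have h0 := ht.1
    have h1 : HasDerivAt (fun t : ℝ => 1 / 2 * (t ^ 2 - t)) (1 / 2 * (2 * t - 1)) t := by
      have := (((hasDerivAt_id t).pow 2).sub (hasDerivAt_id t)).const_mul (1 / 2 : ℝ)
      simpa using this
    have h2 : HasDerivAt (fun t : ℝ => log (t + m)) (1 / (t + m)) t :=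
      ((hasDerivAt_id t).add_const (m:ℝ)).log (by simp; positivity)
    convert! h1.mul h2 using 1
    ring
  have h := intervalIntegral.integral_eq_sub_of_hasDerivAt_of_le (by norm_num) hc hd
    (i1.sub (i2.const_mul _))
  rw [intervalIntegral.integral_sub i1 (i2.const_mul _), intervalIntegral.integral_const_mul] at h
  norm_num at h ⊢
  linarith

lemma logGamma_int : IntervalIntegrable (fun t : ℝ => log (Gamma t)) volume 0 1 := by
  have h1 : IntervalIntegrable (fun t : ℝ => log (Gamma (t + 1))) volume 0 1 := by
    apply ContinuousOn.intervalIntegrable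
    intro t ht
    rw [Set.uIcc_of_le (by norm_num)] at ht
    have h0 := ht.1
    apply ContinuousAt.continuousWithinAt
    have hg : ContinuousAt Gamma (t + 1) :=
      (differentiableAt_Gamma fun m => by have : (0:ℝ) ≤ m := m.cast_nonneg; linarith).continuousAt
    have : ContinuousAt (fun t => Gamma (t + 1)) t :=
      ContinuousAt.comp (f := fun t : ℝ => t + 1) hg (by fun_prop)
    exact this.log (Gamma_pos_of_pos (by positivity)).ne'
  refine (h1.sub (by simpa using log_int 0)).congr (g := fun t : ℝ => log (Gamma t)) (f := fun t => log (Gamma (t + 1)) - log t) ?_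
  intro t ht
  rw [Set.uIoc_of_le (by norm_num)] at ht
  have := ht.1
  dsimp only
  rw [Gamma_add_one this.ne', log_mul this.ne' (Gamma_pos_of_pos this).ne']
  ring

lemma raabe : ∫ t in (0:ℝ)..1, log (Gamma t) = 1 / 2 * log (2 * π) := by
  have hr : ∫ t in (0:ℝ)..1, log (Gamma (1 - t)) = ∫ t in (0:ℝ)..1, log (Gamma t) := by
    rw [intervalIntegral.integral_comp_sub_left (fun t => log (Gamma t)) 1]
    simp
  have hi : IntervalIntegrable (fun t : ℝ => log (Gamma (1 - t))) volume 0 1 := by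
    have := logGamma_int.comp_sub_left 1
    simpa using this.symm
  have hs : ∫ t in (0:ℝ)..1, log (sin (π * t)) = - log 2 := by
    rw [intervalIntegral.integral_comp_mul_left (fun t => log (sin t)) pi_ne_zero]
    rw [mul_zero, mul_one, integral_log_sin_zero_pi, smul_eq_mul]
    field_simp
  have hsi : IntervalIntegrable (fun t : ℝ => log π - log (sin (π * t))) volume 0 1 := by
    refine (logGamma_int.add hi).congr_ae ?_
    rw [Set.uIoc_of_le (by norm_num), ← restrict_Ioo_eq_restrict_Ioc]
    filter_upwards [ae_restrict_mem measurableSet_Ioo] with t ht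
    have h1 := Gamma_pos_of_pos ht.1
    have h2 := Gamma_pos_of_pos (sub_pos.2 ht.2)
    have h3 : 0 < sin (π * t) := sin_pos_of_pos_of_lt_pi (mul_pos pi_pos ht.1)
      (by nlinarith [pi_pos, ht.2])
    rw [← log_mul h1.ne' h2.ne', Gamma_mul_Gamma_one_sub, log_div pi_ne_zero h3.ne']
  have hsi' : IntervalIntegrable (fun t : ℝ => log (sin (π * t))) volume 0 1 := by
    have := (intervalIntegrable_const (c := log π) (a := 0) (b := 1) (μ := volume)).sub hsi
    simpa using this
  have e : ∫ t in (0:ℝ)..1, (log (Gamma t) + log (Gamma (1 - t))) =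
      ∫ t in (0:ℝ)..1, (log π - log (sin (π * t))) := by
    rw [intervalIntegral.integral_of_le (by norm_num), intervalIntegral.integral_of_le (by norm_num),
      integral_Ioc_eq_integral_Ioo, integral_Ioc_eq_integral_Ioo]
    apply setIntegral_congr_fun measurableSet_Ioo
    intro t ht
    have h1 := Gamma_pos_of_pos ht.1
    have h2 := Gamma_pos_of_pos (sub_pos.2 ht.2)
    have h3 : 0 < sin (π * t) := sin_pos_of_pos_of_lt_pi (mul_pos pi_pos ht.1)
      (by nlinarith [pi_pos, ht.2])
    dsimp only
    rw [← log_mul h1.ne' h2.ne', Gamma_mul_Gamma_one_sub, log_div pi_ne_zero h3.ne']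
  rw [intervalIntegral.integral_add logGamma_int hi, hr,
    intervalIntegral.integral_sub intervalIntegrable_const hsi', hs] at e
  simp at e
  rw [log_mul (by norm_num) pi_ne_zero]
  linarith

lemma seq_integral (n : ℕ) : ∫ t in (0:ℝ)..1, (t - 1 / 2) * BohrMollerup.logGammaSeq t n =
    1 / 12 * log n - 1 / 2 * ∑ m ∈ Finset.range (n + 1), ∫ t in (0:ℝ)..1, t * (1 - t) / (t + m) := by
  have i1 : ∀ m : ℕ, IntervalIntegrable (fun t : ℝ => (t - 1 / 2) * log (t + m)) volume 0 1 :=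
    fun m => (log_int m).continuousOn_mul (by fun_prop)
  have i2 : IntervalIntegrable (fun t : ℝ => (t - 1 / 2) * (t * log n + log (n.factorial))) volume 0 1 := by
    apply Continuous.intervalIntegrable
    fun_prop
  have hd : ∀ t ∈ Set.uIcc (0:ℝ) 1, HasDerivAt
      (fun t : ℝ => (t ^ 3 / 3 - t ^ 2 / 4) * log n + (t ^ 2 / 2 - t / 2) * log (n.factorial))
      ((t - 1 / 2) * (t * log n + log (n.factorial))) t := by
    intro t _
    have h := (((((hasDerivAt_id t).pow 3).div_const 3).sub (((hasDerivAt_id t).pow 2).div_const 4)).mul_const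
      (log n)).add (((((hasDerivAt_id t).pow 2).div_const 2).sub ((hasDerivAt_id t).div_const 2)).mul_const
      (log (n.factorial)))
    convert! h using 1
    simp
    ring
  have e : ∀ t : ℝ, (t - 1 / 2) * BohrMollerup.logGammaSeq t n =
      (t - 1 / 2) * (t * log n + log (n.factorial)) -
        ∑ m ∈ Finset.range (n + 1), (t - 1 / 2) * log (t + m) := by
    intro t
    rw [BohrMollerup.logGammaSeq, mul_sub, Finset.mul_sum]
  simp_rw [e]
  have i3 : IntervalIntegrable (fun t : ℝ => ∑ m ∈ Finset.range (n + 1), (t - 1 / 2) * log (t + m)) volume 0 1 := by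
    have := IntervalIntegrable.sum (μ := volume) (a := 0) (b := 1) (Finset.range (n + 1))
      (f := fun (m : ℕ) (t : ℝ) => (t - 1 / 2) * log (t + m)) (fun m _ => i1 m)
    convert! this using 1
    ext t
    simp
  rw [intervalIntegral.integral_sub i2 i3, intervalIntegral.integral_finsetSum (fun m _ => i1 m),
    intervalIntegral.integral_eq_sub_of_hasDerivAt hd i2, Finset.mul_sum,
    Finset.sum_congr rfl (fun m _ => parts m)]
  ring

lemma seq_int (n : ℕ) : IntervalIntegrable (fun t : ℝ => (t - 1 / 2) * BohrMollerup.logGammaSeq t n) volume 0 1 := by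
  refine IntervalIntegrable.continuousOn_mul ?_ (by fun_prop)
  unfold BohrMollerup.logGammaSeq
  refine IntervalIntegrable.sub (by apply Continuous.intervalIntegrable; fun_prop) ?_
  have := IntervalIntegrable.sum (μ := volume) (a := 0) (b := 1) (Finset.range (n + 1))
      (f := fun (m : ℕ) (t : ℝ) => log (t + m)) (fun m _ => log_int m)
  convert! this using 1
  ext t
  simp

lemma feq {y : ℝ} (hy : 0 < y) : (log ∘ Gamma) (y + 1) = (log ∘ Gamma) y + log y := by
  simp only [Function.comp_apply]
  rw [Gamma_add_one hy.ne', log_mul hy.ne' (Gamma_pos_of_pos hy).ne']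
  ring

lemma seq_lim : Tendsto (fun n : ℕ => ∫ t in (0:ℝ)..1, (t - 1 / 2) * BohrMollerup.logGammaSeq t n) atTop
    (𝓝 (∫ t in (0:ℝ)..1, (t - 1 / 2) * log (Gamma t))) := by
  have iG : IntervalIntegrable (fun t : ℝ => (t - 1 / 2) * log (Gamma t)) volume 0 1 :=
    logGamma_int.continuousOn_mul (by fun_prop)
  rw [tendsto_iff_norm_sub_tendsto_zero]
  have hz : Tendsto (fun n : ℕ => log ((n:ℝ) + 1) - log n) atTop (𝓝 0) :=
    (tendsto_log_comp_add_sub_log 1).comp tendsto_natCast_atTop_atTop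
  refine squeeze_zero' (Eventually.of_forall fun n => norm_nonneg _) ?_ hz
  filter_upwards [eventually_gt_atTop 0] with n hn
  rw [← intervalIntegral.integral_sub (seq_int n) iG]
  have hn' : (0:ℝ) < n := by exact_mod_cast hn
  have hlog : 0 ≤ log ((n:ℝ) + 1) - log n :=
    sub_nonneg.2 (log_le_log hn' (by linarith))
  have := intervalIntegral.norm_integral_le_of_norm_le_const (a := 0) (b := 1)
    (f := fun t : ℝ => (t - 1 / 2) * BohrMollerup.logGammaSeq t n - (t - 1 / 2) * log (Gamma t))
    (C := log ((n:ℝ) + 1) - log n) ?_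
  · simpa using this
  intro t ht
  rw [Set.uIoc_of_le (by norm_num)] at ht
  have hge := BohrMollerup.ge_logGammaSeq convexOn_log_Gamma feq ht.1 hn.ne'
  have hle := BohrMollerup.le_logGammaSeq convexOn_log_Gamma feq ht.1 ht.2 n
  simp only [Function.comp_apply, Gamma_one, log_one, zero_add] at hge hle
  rw [← mul_sub, norm_mul, norm_eq_abs, norm_eq_abs]
  have h1 : |t - 1 / 2| ≤ 1 := by rw [abs_le]; constructor <;> linarith [ht.1, ht.2]
  have h2 : |BohrMollerup.logGammaSeq t n - log (Gamma t)| ≤ log ((n:ℝ) + 1) - log n := by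
    rw [abs_le]
    constructor
    · nlinarith [ht.2]
    · linarith
  calc _ ≤ 1 * (log ((n:ℝ) + 1) - log n) := mul_le_mul h1 h2 (abs_nonneg _) zero_le_one
    _ = _ := one_mul _

lemma half : ∫ t in (0:ℝ)..1, (t - 1 / 2) * log (Gamma t) =
    (deriv riemannZeta 2).re / (2 * π^2) - 1 / 12 * (eulerMascheroniConstant + log (2 * π)) := by
  refine tendsto_nhds_unique seq_lim ?_
  have hz : Tendsto (fun n : ℕ => log ((n:ℝ) + 1) - log n) atTop (𝓝 0) :=
    (tendsto_log_comp_add_sub_log 1).comp tendsto_natCast_atTop_atTop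
  have h := ((sum_lim.comp (tendsto_add_atTop_nat 1)).const_mul (-1 / (2 * π ^ 2))).sub
    (hz.const_mul (1 / 12))
  convert! h using 1
  · ext n
    rw [seq_integral]
    simp only [Function.comp_apply]
    push_cast
    field_simp
    ring
  · congr 1
    field_simp
    ring

end ITLG

theorem integral_t_log_Gamma :
    ∫ t in (0:ℝ)..1, t * Real.log (Real.Gamma t)
      = (deriv riemannZeta 2).re / (2 * π^2) + (1/6) * Real.log (2 * π)
        - Real.eulerMascheroniConstant / 12 := by
  have iG : IntervalIntegrable (fun t : ℝ => (t - 1 / 2) * log (Gamma t)) volume 0 1 :=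
    ITLG.logGamma_int.continuousOn_mul (by fun_prop)
  have e : ∀ t : ℝ, t * log (Gamma t) = (t - 1 / 2) * log (Gamma t) + 1 / 2 * log (Gamma t) := by
    intro t; ring
  simp_rw [e]
  rw [intervalIntegral.integral_add iG (ITLG.logGamma_int.const_mul _), ITLG.half,
    intervalIntegral.integral_const_mul, ITLG.raabe]
  ring
end
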